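/- arXiv:2008.13531 — 3 statements merged into one kernel-verified Lean document; each statement's English description precedes it below -/
import Mathlib

section
/- Singular limit of the Delaunay Jacobi field. Assume the family (a,t) ↦ (x_a(t), z_a(t)) is differentiable with respect to a on (−1/2, ∞) ∖ {0} and set w_{a,0}^+(t) = −(z_a'(t)/x_a(t))·∂_a x_a(t) + (x_a'(t)/x_a(t))·∂_a z_a(t). Then w_{a,0}^+ → w₀ in C²_loc(ℝ) as a → 0, where w₀(t) = −1 + t·tanh t; moreover, for every fixed a₀ ∈ (0, 1/2) there exists C > 0 such that |w_{a,0}^+(t)| ≤ C(1 + |t|) for every t ∈ ℝ and every a ∈ [−a₀, a₀] ∖ {0}. -/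
noncomputable section

namespace Delaunay

/-- Vectors in ℝ³. -/
abbrev V3 : Type := Fin 3 → ℝ

/-- Euclidean scalar product on ℝ³. -/
def dot3 (v w : V3) : ℝ := v 0 * w 0 + v 1 * w 1 + v 2 * w 2

/-- Euclidean norm on ℝ³. -/
def norm3 (v : V3) : ℝ := Real.sqrt (dot3 v v)

/-- Cross product on ℝ³. -/
def cross3 (v w : V3) : V3 :=
  ![v 1 * w 2 - v 2 * w 1, v 2 * w 0 - v 0 * w 2, v 0 * w 1 - v 1 * w 0]

/-- Partial derivative with respect to the first variable. -/
def pt {E : Type*} [NormedAddCommGroup E] [NormedSpace ℝ E] (X : ℝ → ℝ → E) (t θ : ℝ) : E :=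
  deriv (fun s => X s θ) t

/-- Partial derivative with respect to the second variable. -/
def pθ {E : Type*} [NormedAddCommGroup E] [NormedSpace ℝ E] (X : ℝ → ℝ → E) (t θ : ℝ) : E :=
  deriv (fun s => X t s) θ

/-- Unit normal vector of a parametrized surface. -/
def normalVec (X : ℝ → ℝ → V3) (t θ : ℝ) : V3 :=
  (norm3 (cross3 (pt X t θ) (pθ X t θ)))⁻¹ • cross3 (pt X t θ) (pθ X t θ)

/-- Mean curvature of a parametrized surface, 𝔐 = (𝓔𝓝 − 2𝓕𝓜 + 𝓖𝓛)/(2(𝓔𝓖 − 𝓕²)). -/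
def meanCurv (X : ℝ → ℝ → V3) (t θ : ℝ) : ℝ :=
  (dot3 (pt X t θ) (pt X t θ) * dot3 (pθ (pθ X) t θ) (normalVec X t θ)
    - 2 * dot3 (pt X t θ) (pθ X t θ) * dot3 (pθ (pt X) t θ) (normalVec X t θ)
    + dot3 (pθ X t θ) (pθ X t θ) * dot3 (pt (pt X) t θ) (normalVec X t θ))
  / (2 * (dot3 (pt X t θ) (pt X t θ) * dot3 (pθ X t θ) (pθ X t θ)
      - dot3 (pt X t θ) (pθ X t θ) ^ 2))

/-- Delaunay cylinder parametrization X_a. -/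
def cyl (x z : ℝ → ℝ) : ℝ → ℝ → V3 := fun t θ =>
  ![x t * Real.cos θ, x t * Real.sin θ, z t]

/-- Delaunay torus parametrization X_{ε,a}. -/
def torus (x z : ℝ → ℝ) (ε : ℝ) : ℝ → ℝ → V3 := fun t θ =>
  ![x t * Real.cos θ,
    (ε⁻¹ + x t * Real.sin θ) * Real.cos (ε * z t),
    (ε⁻¹ + x t * Real.sin θ) * Real.sin (ε * z t)]

/-- Normal graph X + φN over a parametrized surface. -/
def graphMap (X : ℝ → ℝ → V3) (φ : ℝ → ℝ → ℝ) : ℝ → ℝ → V3 := fun t θ =>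
  X t θ + φ t θ • normalVec X t θ

/-- Normal perturbation family s ↦ X + sφN. -/
def pert (X : ℝ → ℝ → V3) (φ : ℝ → ℝ → ℝ) (s : ℝ) : ℝ → ℝ → V3 := fun t θ =>
  X t θ + (s * φ t θ) • normalVec X t θ

/-- Pointwise C² quantity |φ| + |∇φ| + |D²φ|. -/
def C2w (φ : ℝ → ℝ → ℝ) (t θ : ℝ) : ℝ :=
  |φ t θ| + ‖fderiv ℝ (fun p : ℝ × ℝ => φ p.1 p.2) (t, θ)‖
    + ‖fderiv ℝ (fderiv ℝ (fun p : ℝ × ℝ => φ p.1 p.2)) (t, θ)‖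

/-- The normalized Jacobi operator 𝓛 φ = 2x²·(d/ds)[𝔐(X + sφN)]|_{s=0}. -/
def jacobiAt (x : ℝ → ℝ) (X : ℝ → ℝ → V3) (φ : ℝ → ℝ → ℝ) (t θ : ℝ) : ℝ :=
  deriv (fun s : ℝ => 2 * x t ^ 2 * meanCurv (pert X φ s) t θ) 0

/-- The normalized Jacobi operator of the Delaunay cylinder: 𝓛_a φ = Δφ + 2(x² + γ²/x²)φ. -/
def Lop (x : ℝ → ℝ) (γ : ℝ) (φ : ℝ → ℝ → ℝ) (t θ : ℝ) : ℝ :=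
  pt (pt φ) t θ + pθ (pθ φ) t θ + 2 * (x t ^ 2 + γ ^ 2 / x t ^ 2) * φ t θ

/-- The first-order operator 𝓛_a^{(1)} in the expansion of the Jacobi operator of Delaunay
tori (here z_a' = x_a² − γ_a). -/
def L1op (x x' : ℝ → ℝ) (γ : ℝ) (φ : ℝ → ℝ → ℝ) (t θ : ℝ) : ℝ :=
  (-2 * (x t ^ 2 - γ) ^ 2 / x t * Real.sin θ) * pt (pt φ) t θ
  + (((x t ^ 2 - γ) ^ 2 * x' t / x t ^ 2 - 4 * (x t ^ 2 - γ) * x' t) * Real.sin θ) * pt φ t θ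
  + ((x t ^ 2 - γ) ^ 2 / x t * Real.cos θ) * pθ φ t θ
  + 2 * (((x t + γ / x t) * (2 * x t ^ 2 + (x t ^ 2 - γ) - (x t ^ 2 - γ) ^ 3 / x t)
      - 4 * ((x t ^ 2 - γ) ^ 2 / x t) * (x t + γ / x t) ^ 2
      + (x' t ^ 2 / x t) * (x t - γ / x t) ^ 2) * Real.sin θ) * φ t θ

/-- The first variation of the mean curvature along a normal perturbation of an orthogonal
parametrization. -/
def firstVariation (X : ℝ → ℝ → V3) (φ : ℝ → ℝ → ℝ) (t θ : ℝ) : ℝ :=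
  let E := dot3 (pt X t θ) (pt X t θ)
  let G := dot3 (pθ X t θ) (pθ X t θ)
  let N := normalVec X t θ
  let L := dot3 (pt (pt X) t θ) N
  let M := dot3 (pθ (pt X) t θ) N
  let Q := dot3 (pθ (pθ X) t θ) N
  let Nt2 := dot3 (pt (normalVec X) t θ) (pt (normalVec X) t θ)
  let Nθ2 := dot3 (pθ (normalVec X) t θ) (pθ (normalVec X) t θ)
  let dtE := pt (fun u v => dot3 (pt X u v) (pt X u v)) t θ
  let dθE := pθ (fun u v => dot3 (pt X u v) (pt X u v)) t θ
  let dtG := pt (fun u v => dot3 (pθ X u v) (pθ X u v)) t θ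
  let dθG := pθ (fun u v => dot3 (pθ X u v) (pθ X u v)) t θ
  (1 / (2 * E)) * pt (pt φ) t θ + (1 / (2 * G)) * pθ (pθ φ) t θ
  + (dtG / (4 * E * G) - dtE / (4 * E ^ 2)) * pt φ t θ
  + (dθE / (4 * E * G) - dθG / (4 * G ^ 2)) * pθ φ t θ
  + (2 * M ^ 2 / (E * G) - Nθ2 / (2 * G) - Nt2 / (2 * E) + L ^ 2 / E ^ 2 + Q ^ 2 / G ^ 2)
      * φ t θ

/-- The second variation of the mean curvature along a normal perturbation of an orthogonal
parametrization. -/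
def secondVariation (X : ℝ → ℝ → V3) (φ : ℝ → ℝ → ℝ) (t θ : ℝ) : ℝ :=
  let E := dot3 (pt X t θ) (pt X t θ)
  let G := dot3 (pθ X t θ) (pθ X t θ)
  let N := normalVec X t θ
  let L := dot3 (pt (pt X) t θ) N
  let M := dot3 (pθ (pt X) t θ) N
  let Q := dot3 (pθ (pθ X) t θ) N
  let P := dot3 (pt (normalVec X) t θ) (pθ (normalVec X) t θ)
  let Nt2 := dot3 (pt (normalVec X) t θ) (pt (normalVec X) t θ)
  let Nθ2 := dot3 (pθ (normalVec X) t θ) (pθ (normalVec X) t θ)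
  let dtE := pt (fun u v => dot3 (pt X u v) (pt X u v)) t θ
  let dθE := pθ (fun u v => dot3 (pt X u v) (pt X u v)) t θ
  let dtG := pt (fun u v => dot3 (pθ X u v) (pθ X u v)) t θ
  let dθG := pθ (fun u v => dot3 (pθ X u v) (pθ X u v)) t θ
  let Ntt := pt (pt (normalVec X)) t θ
  let Nθθ := pθ (pθ (normalVec X)) t θ
  pt φ t θ ^ 2 * (L / (2 * E ^ 2) - Q / (2 * E * G))
  + pθ φ t θ ^ 2 * (-(L / (2 * E * G)) + Q / (2 * G ^ 2))
  + φ t θ ^ 2 * (-(6 * P * M / (E * G)) + 12 * L * M ^ 2 / (E ^ 2 * G)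
      + 12 * Q * M ^ 2 / (E * G ^ 2) - 3 * L * Nt2 / E ^ 2 - 3 * Q * Nθ2 / G ^ 2
      + 4 * L ^ 3 / E ^ 3 + 4 * Q ^ 3 / G ^ 3)
  + pt φ t θ * pθ φ t θ * (2 * M / (E * G))
  + φ t θ * pt φ t θ * (-(dot3 Nθθ (pt X t θ) / (E * G)) - dot3 Ntt (pt X t θ) / E ^ 2
      - (3 / 2) * L * dtE / E ^ 3 + Q * dtG / (E * G ^ 2) + (1 / 2) * L * dtG / (E ^ 2 * G)
      - (1 / 2) * M * dθG / (E * G ^ 2) - (3 / 2) * M * dθE / (E ^ 2 * G))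
  + φ t θ * pθ φ t θ * (-(dot3 Ntt (pθ X t θ) / (E * G)) - dot3 Nθθ (pθ X t θ) / G ^ 2
      - (3 / 2) * Q * dθG / G ^ 3 + L * dθE / (E ^ 2 * G) + (1 / 2) * Q * dθE / (E * G ^ 2)
      - (1 / 2) * M * dtE / (E ^ 2 * G) - (3 / 2) * M * dtG / (E * G ^ 2))
  + φ t θ * pθ (pθ φ) t θ * (2 * Q / G ^ 2)
  + φ t θ * pt (pt φ) t θ * (2 * L / E ^ 2)
  + φ t θ * pθ (pt φ) t θ * (4 * M / (E * G))

/-- The Jacobi field w_{a,0}^+ coming from the Delaunay parameter. -/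
def wplus (x x' dx dz : ℝ → ℝ → ℝ) (a t : ℝ) : ℝ :=
  -((x a t ^ 2 - a * (1 + a)) / x a t) * dx a t + (x' a t / x a t) * dz a t

lemma hda {f g : ℝ → ℝ} {f' g' t : ℝ} (h : HasDerivAt g g' t) (hf : ∀ s, f s = g s)
    (hd : f' = g') : HasDerivAt f f' t := by
  have : f = g := funext hf
  rw [this, hd]; exact h

/-- A solution of the Delaunay system with parameter `a`. -/
structure Sol (a : ℝ) (x y z : ℝ → ℝ) : Prop where
  hx : ∀ t, HasDerivAt x (y t) t
  hy : ∀ t, HasDerivAt y ((1 + 2 * (a * (1 + a))) * x t - 2 * x t ^ 3) t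
  hz : ∀ t, HasDerivAt z (x t ^ 2 - a * (1 + a)) t
  x0 : x 0 = 1 + a
  y0 : y 0 = 0
  z0 : z 0 = 0

lemma gron (f f' : ℝ → ℝ) (T K e : ℝ) (hK : 0 ≤ K) (he : 0 ≤ e)
    (hf : ∀ t, 0 ≤ t → t ≤ T → HasDerivAt f (f' t) t)
    (hb : ∀ t, 0 ≤ t → t ≤ T → f' t ≤ K * f t + e) (h0 : f 0 ≤ e) (t : ℝ)
    (ht0 : 0 ≤ t) (htT : t ≤ T) : f t ≤ e * (1 + T) * Real.exp (K * T) := by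
  have hg : ∀ s, 0 ≤ s → s ≤ T → HasDerivAt (fun s => f s * Real.exp (-K * s) - e * s)
      (f' s * Real.exp (-K * s) + f s * (Real.exp (-K * s) * (-K * 1)) - e * 1) s := by
    intro s h1 h2
    exact ((hf s h1 h2).mul (((hasDerivAt_id s).const_mul (-K)).exp)).sub
      ((hasDerivAt_id s).const_mul e)
  have hanti : AntitoneOn (fun s => f s * Real.exp (-K * s) - e * s) (Set.Icc 0 T) := by
    apply antitoneOn_of_deriv_nonpos (convex_Icc 0 T)
    · intro s hs
      exact (hg s hs.1 hs.2).continuousAt.continuousWithinAt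
    · intro s hs
      rw [interior_Icc] at hs
      exact (hg s hs.1.le hs.2.le).differentiableAt.differentiableWithinAt
    · intro s hs
      rw [interior_Icc] at hs
      rw [(hg s hs.1.le hs.2.le).deriv]
      have h1 := hb s hs.1.le hs.2.le
      have h2 : Real.exp (-K * s) ≤ 1 := by
        rw [Real.exp_le_one_iff]; nlinarith [hs.1]
      have h3 := Real.exp_pos (-K * s)
      nlinarith
  have h := hanti (⟨le_rfl, ht0.trans htT⟩ : (0:ℝ) ∈ Set.Icc 0 T) ⟨ht0, htT⟩ ht0
  simp only [mul_zero, Real.exp_zero, mul_one, sub_zero] at h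
  have h4 : f t * Real.exp (-K * t) ≤ e * (1 + T) := by nlinarith
  have h5 : f t = f t * Real.exp (-K * t) * Real.exp (K * t) := by
    rw [mul_assoc, ← Real.exp_add]; simp
  rw [h5]
  have h6 : Real.exp (K * t) ≤ Real.exp (K * T) := Real.exp_le_exp.2 (by nlinarith)
  have h7 := Real.exp_pos (K * t)
  have h8 : 0 ≤ e * (1 + T) := mul_nonneg he (by linarith)
  calc _ ≤ e * (1 + T) * Real.exp (K * t) := mul_le_mul_of_nonneg_right h4 h7.le
    _ ≤ _ := mul_le_mul_of_nonneg_left h6 h8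

lemma stab_alg (r ρ s A B R1 R2 K ε : ℝ) (hA : |A| ≤ K) (hB : |B| ≤ K) (h1 : |R1| ≤ ε)
    (h2 : |R2| ≤ ε) :
    2 * r * ρ + 2 * ρ * (A * r + R1) + 2 * s * (B * r + R2)
      ≤ (2 * K + 2) * (r ^ 2 + ρ ^ 2 + s ^ 2) + 2 * ε ^ 2 := by
  obtain ⟨a1, a2⟩ := abs_le.1 hA
  obtain ⟨b1, b2⟩ := abs_le.1 hB
  have e1 : R1 ^ 2 ≤ ε ^ 2 := sq_le_sq' (abs_le.1 h1).1 (abs_le.1 h1).2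
  have e2 : R2 ^ 2 ≤ ε ^ 2 := sq_le_sq' (abs_le.1 h2).1 (abs_le.1 h2).2
  have k1 : 2 * ρ * (A * r) ≤ K * (ρ ^ 2 + r ^ 2) := by
    nlinarith [mul_nonneg (by linarith : 0 ≤ K - A) (sq_nonneg (ρ + r)),
      mul_nonneg (by linarith : 0 ≤ K + A) (sq_nonneg (ρ - r))]
  have k2 : 2 * s * (B * r) ≤ K * (s ^ 2 + r ^ 2) := by
    nlinarith [mul_nonneg (by linarith : 0 ≤ K - B) (sq_nonneg (s + r)),
      mul_nonneg (by linarith : 0 ≤ K + B) (sq_nonneg (s - r))]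
  have hK : 0 ≤ K := by linarith
  nlinarith [sq_nonneg (r - ρ), sq_nonneg (ρ - R1), sq_nonneg (s - R2),
    mul_nonneg hK (sq_nonneg s), mul_nonneg hK (sq_nonneg ρ), sq_nonneg r, sq_nonneg s]

lemma stab_pos (r ρ s A B R1 R2 : ℝ → ℝ) (T K ε : ℝ) (hT : 0 ≤ T)
    (hr : ∀ t, HasDerivAt r (ρ t) t)
    (hρ : ∀ t, HasDerivAt ρ (A t * r t + R1 t) t)
    (hs : ∀ t, HasDerivAt s (B t * r t + R2 t) t)
    (hA : ∀ t, |t| ≤ T → |A t| ≤ K) (hB : ∀ t, |t| ≤ T → |B t| ≤ K)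
    (h1 : ∀ t, |t| ≤ T → |R1 t| ≤ ε) (h2 : ∀ t, |t| ≤ T → |R2 t| ≤ ε)
    (h0 : r 0 ^ 2 + ρ 0 ^ 2 + s 0 ^ 2 ≤ ε ^ 2) (t : ℝ) (ht0 : 0 ≤ t) (ht : t ≤ T) :
    r t ^ 2 + ρ t ^ 2 + s t ^ 2 ≤ 2 * ε ^ 2 * (1 + T) * Real.exp ((2 * K + 2) * T) := by
  have hK : 0 ≤ K := (abs_nonneg _).trans (hA 0 (by simpa using hT))
  refine gron (fun t => r t ^ 2 + ρ t ^ 2 + s t ^ 2)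
    (fun t => 2 * r t * ρ t + 2 * ρ t * (A t * r t + R1 t) + 2 * s t * (B t * r t + R2 t))
    T (2 * K + 2) (2 * ε ^ 2) (by linarith) (by positivity) ?_ ?_ ?_ t ht0 ht
  · intro t _ _
    have := (((hr t).pow 2).add ((hρ t).pow 2)).add ((hs t).pow 2)
    refine hda this (fun s => by rfl) ?_
    norm_num
  · intro t h3 h4
    have h5 : |t| ≤ T := by rwa [abs_of_nonneg h3]
    exact stab_alg _ _ _ _ _ _ _ _ _ (hA t h5) (hB t h5) (h1 t h5) (h2 t h5)
  · nlinarith [sq_nonneg ε]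

lemma stab (r ρ s A B R1 R2 : ℝ → ℝ) (T K ε : ℝ) (hT : 0 ≤ T)
    (hr : ∀ t, HasDerivAt r (ρ t) t)
    (hρ : ∀ t, HasDerivAt ρ (A t * r t + R1 t) t)
    (hs : ∀ t, HasDerivAt s (B t * r t + R2 t) t)
    (hA : ∀ t, |t| ≤ T → |A t| ≤ K) (hB : ∀ t, |t| ≤ T → |B t| ≤ K)
    (h1 : ∀ t, |t| ≤ T → |R1 t| ≤ ε) (h2 : ∀ t, |t| ≤ T → |R2 t| ≤ ε)
    (h0 : r 0 ^ 2 + ρ 0 ^ 2 + s 0 ^ 2 ≤ ε ^ 2) (t : ℝ) (ht : |t| ≤ T) :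
    r t ^ 2 + ρ t ^ 2 + s t ^ 2 ≤ 2 * ε ^ 2 * (1 + T) * Real.exp ((2 * K + 2) * T) := by
  rcases le_total 0 t with h | h
  · exact stab_pos r ρ s A B R1 R2 T K ε hT hr hρ hs hA hB h1 h2 h0 t h
      (by rwa [abs_of_nonneg h] at ht)
  · have key := stab_pos (fun t => r (-t)) (fun t => -ρ (-t)) (fun t => -s (-t))
      (fun t => A (-t)) (fun t => B (-t)) (fun t => R1 (-t)) (fun t => R2 (-t)) T K ε hT
      (fun t => hda ((hr (-t)).comp t (hasDerivAt_neg t)) (fun s => by rfl) (by simp))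
      (fun t => hda (((hρ (-t)).comp t (hasDerivAt_neg t)).neg) (fun s => by rfl) (by simp))
      (fun t => hda (((hs (-t)).comp t (hasDerivAt_neg t)).neg) (fun s => by rfl) (by simp))
      (fun t ht => hA _ (by rwa [abs_neg])) (fun t ht => hB _ (by rwa [abs_neg]))
      (fun t ht => h1 _ (by rwa [abs_neg])) (fun t ht => h2 _ (by rwa [abs_neg]))
      (by simpa using h0) (-t) (by linarith) (by rwa [abs_of_nonpos h] at ht)
    simpa using key

lemma Sol.energy {a : ℝ} {x y z : ℝ → ℝ} (h : Sol a x y z) (t : ℝ) :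
    y t ^ 2 = x t ^ 2 - (x t ^ 2 - a * (1 + a)) ^ 2 := by
  have hd : ∀ t, HasDerivAt (fun t => y t ^ 2 - (x t ^ 2 - (x t ^ 2 - a * (1 + a)) ^ 2)) 0 t := by
    intro t
    have := ((h.hy t).pow 2).sub (((h.hx t).pow 2).sub ((((h.hx t).pow 2).sub_const (a * (1 + a))).pow 2))
    refine hda this (fun s => by rfl) ?_
    simp only [Pi.pow_apply]
    push_cast
    ring
  have hc := is_const_of_deriv_eq_zero (fun t => (hd t).differentiableAt) (fun t => (hd t).deriv) t 0
  simp only [h.x0, h.y0] at hc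
  linarith [hc, show (0:ℝ) ^ 2 - ((1 + a) ^ 2 - ((1 + a) ^ 2 - a * (1 + a)) ^ 2) = 0 by ring]

lemma Sol.bound {a : ℝ} {x y z : ℝ → ℝ} (h : Sol a x y z) (t : ℝ) :
    |x t| ≤ 1 + |a * (1 + a)| := by
  have he := h.energy t
  have h1 : |x t ^ 2 - a * (1 + a)| ≤ |x t| := sq_le_sq.1 (by nlinarith [sq_nonneg (y t)])
  have h2 := (abs_le.1 h1).2
  have h3 := le_abs_self (a * (1 + a))
  have h4 := abs_nonneg (a * (1 + a))
  by_contra hc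
  push Not at hc
  nlinarith [sq_abs (x t)]

lemma Sol.ne {a : ℝ} {x y z : ℝ → ℝ} (h : Sol a x y z) (ha : a * (1 + a) ≠ 0) (t : ℝ) :
    x t ≠ 0 := by
  intro hx
  have he := h.energy t
  rw [hx] at he
  have : 0 < (a * (1 + a)) ^ 2 := by positivity
  nlinarith [sq_nonneg (y t)]

lemma sol_sech : Sol 0 (fun t => 1 / Real.cosh t) (fun t => -Real.sinh t / Real.cosh t ^ 2)
    Real.tanh where
  hx t := by
    have := (Real.hasDerivAt_cosh t).inv (Real.cosh_pos t).ne'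
    exact hda this (fun s => by simp) rfl
  hy t := by
    have hc := (Real.cosh_pos t).ne'
    have := ((Real.hasDerivAt_sinh t).neg).div ((Real.hasDerivAt_cosh t).pow 2) (pow_ne_zero 2 hc)
    refine hda this (fun s => by rfl) ?_
    simp only [Pi.neg_apply, Pi.pow_apply]
    field_simp
    have := Real.cosh_sq t
    push_cast
    simp only [pow_one]
    linear_combination 2 * Real.cosh t * this
  hz t := by
    have hc := (Real.cosh_pos t).ne'
    have := (Real.hasDerivAt_sinh t).div (Real.hasDerivAt_cosh t) hc
    have h2 : Real.tanh = Real.sinh / Real.cosh := by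
      funext t; exact Real.tanh_eq_sinh_div_cosh t
    rw [h2]
    refine hda this (fun s => by rfl) ?_
    field_simp
    have := Real.cosh_sq t
    linear_combination (-1) * this
  x0 := by simp
  y0 := by simp
  z0 := by simp

/-- Explicit formula for the Jacobi field. -/
def W0 (a t x y z : ℝ) : ℝ :=
  ((1 + 2 * (a * (1 + a))) - 2 * x ^ 2 + (2 * z - t) * (y / x)) / (1 + 2 * a)

/-- Explicit formula for the first derivative of the Jacobi field. -/
def W1 (a t x y z : ℝ) : ℝ :=
  (-4 * x * y + (2 * (x ^ 2 - a * (1 + a)) - 1) * (y / x)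
    + (2 * z - t) * ((a * (1 + a)) ^ 2 / x ^ 2 - x ^ 2)) / (1 + 2 * a)

/-- Explicit formula for the second derivative of the Jacobi field. -/
def W2 (a t x y z : ℝ) : ℝ :=
  -2 * (x ^ 2 + (a * (1 + a)) ^ 2 / x ^ 2) * W0 a t x y z

lemma Sol.dφ {a : ℝ} {x y z : ℝ → ℝ} (h : Sol a x y z) (t : ℝ) (hx : x t ≠ 0) :
    HasDerivAt (fun t => y t / x t) ((a * (1 + a)) ^ 2 / x t ^ 2 - x t ^ 2) t := by
  have := (h.hy t).div (h.hx t) hx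
  refine hda this (fun s => by rfl) ?_
  have he := h.energy t
  field_simp
  linear_combination he

lemma Sol.dW0 {a : ℝ} {x y z : ℝ → ℝ} (h : Sol a x y z) (t : ℝ) (hx : x t ≠ 0) :
    HasDerivAt (fun t => W0 a t (x t) (y t) (z t)) (W1 a t (x t) (y t) (z t)) t := by
  have := (((((h.hx t).pow 2).const_mul 2).const_sub (1 + 2 * (a * (1 + a)))).add
    ((((h.hz t).const_mul 2).sub (hasDerivAt_id t)).mul (h.dφ t hx))).div_const (1 + 2 * a)
  refine hda this (fun s => by rfl) ?_
  simp only [W1, Pi.sub_apply, id]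
  push_cast
  ring

lemma Sol.dW1 {a : ℝ} {x y z : ℝ → ℝ} (h : Sol a x y z) (t : ℝ) (hx : x t ≠ 0)
    (ha : 1 + 2 * a ≠ 0) :
    HasDerivAt (fun t => W1 a t (x t) (y t) (z t)) (W2 a t (x t) (y t) (z t)) t := by
  have hq : HasDerivAt (fun t => (a * (1 + a)) ^ 2 / x t ^ 2 - x t ^ 2)
      (-2 * (a * (1 + a)) ^ 2 * y t / x t ^ 3 - 2 * x t * y t) t := by
    have := ((hasDerivAt_const t ((a * (1 + a)) ^ 2)).div ((h.hx t).pow 2)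
      (pow_ne_zero 2 hx)).sub ((h.hx t).pow 2)
    refine hda this (fun s => by rfl) ?_
    simp only [Pi.pow_apply]
    push_cast
    field_simp
    ring
  have := (((((h.hx t).const_mul (-4)).mul (h.hy t)).add
    ((((((h.hx t).pow 2).sub_const (a * (1 + a))).const_mul 2).sub_const 1).mul (h.dφ t hx))).add
    ((((h.hz t).const_mul 2).sub (hasDerivAt_id t)).mul hq)).div_const (1 + 2 * a)
  refine hda this (fun s => by rfl) ?_
  have he := h.energy t
  simp only [W2, W0, Pi.sub_apply, Pi.pow_apply, id]
  push_cast
  generalize x t = X at *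
  generalize y t = Y at *
  generalize z t = Z at *
  field_simp
  ring

/-- Explicit parameter derivative of `x`. -/
def Vx (a t x y z : ℝ) : ℝ :=
  ((3 + 1 / (a * (1 + a))) * x - x ^ 3 / (a * (1 + a)) + (2 * t + z / (a * (1 + a))) * y)
    / (1 + 2 * a)

/-- Explicit parameter derivative of the velocity. -/
def Vy (a t x y z : ℝ) : ℝ :=
  ((3 + 1 / (a * (1 + a))) * y - 3 * x ^ 2 * y / (a * (1 + a))
    + (2 + (x ^ 2 - a * (1 + a)) / (a * (1 + a))) * y
    + (2 * t + z / (a * (1 + a))) * ((1 + 2 * (a * (1 + a))) * x - 2 * x ^ 3)) / (1 + 2 * a)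

/-- Explicit parameter derivative of `z`. -/
def Vz (a t x y z : ℝ) : ℝ :=
  (x * y / (a * (1 + a)) + (2 * t + z / (a * (1 + a))) * (x ^ 2 - a * (1 + a)) - t + 2 * z)
    / (1 + 2 * a)

lemma Sol.dVx {a : ℝ} {x y z : ℝ → ℝ} (h : Sol a x y z) (t : ℝ) :
    HasDerivAt (fun t => Vx a t (x t) (y t) (z t)) (Vy a t (x t) (y t) (z t)) t := by
  have hl := ((hasDerivAt_id t).const_mul 2).add ((h.hz t).div_const (a * (1 + a)))
  have := ((((h.hx t).const_mul (3 + 1 / (a * (1 + a)))).sub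
    (((h.hx t).pow 3).div_const (a * (1 + a)))).add (hl.mul (h.hy t))).div_const (1 + 2 * a)
  refine hda this (fun s => by rfl) ?_
  simp only [Vy, Pi.add_apply, id]
  push_cast
  ring

lemma Sol.dVy {a : ℝ} {x y z : ℝ → ℝ} (h : Sol a x y z) (t : ℝ) (hg : a * (1 + a) ≠ 0)
    (ha : 1 + 2 * a ≠ 0) :
    HasDerivAt (fun t => Vy a t (x t) (y t) (z t))
      ((1 + 2 * (a * (1 + a))) * Vx a t (x t) (y t) (z t)
        - 6 * x t ^ 2 * Vx a t (x t) (y t) (z t) + 2 * (1 + 2 * a) * x t) t := by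
  have hl := ((hasDerivAt_id t).const_mul 2).add ((h.hz t).div_const (a * (1 + a)))
  have := (((((h.hy t).const_mul (3 + 1 / (a * (1 + a)))).sub
    (((((h.hx t).pow 2).const_mul 3).mul (h.hy t)).div_const (a * (1 + a)))).add
    ((((((h.hx t).pow 2).sub_const (a * (1 + a))).div_const (a * (1 + a))).const_add 2).mul
      (h.hy t))).add (hl.mul (((h.hx t).const_mul (1 + 2 * (a * (1 + a)))).sub
      (((h.hx t).pow 3).const_mul 2)))).div_const (1 + 2 * a)
  refine hda this (fun s => by rfl) ?_
  have he := h.energy t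
  simp only [Vx, Pi.add_apply, Pi.sub_apply, Pi.pow_apply, id]
  push_cast
  generalize x t = X at *
  generalize y t = Y at *
  generalize z t = Z at *
  have h1 : 1 + a ≠ 0 := fun h => hg (by rw [h, mul_zero])
  have h2 : a ≠ 0 := fun h => hg (by rw [h, zero_mul])
  field_simp
  simp only [Nat.add_one_sub_one, pow_one, show 3 - 1 = 2 from rfl] at *
  linear_combination 4 * X * he

lemma Sol.dVz {a : ℝ} {x y z : ℝ → ℝ} (h : Sol a x y z) (t : ℝ) (hg : a * (1 + a) ≠ 0)
    (ha : 1 + 2 * a ≠ 0) :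
    HasDerivAt (fun t => Vz a t (x t) (y t) (z t))
      (2 * x t * Vx a t (x t) (y t) (z t) - (1 + 2 * a)) t := by
  have hl := ((hasDerivAt_id t).const_mul 2).add ((h.hz t).div_const (a * (1 + a)))
  have := ((((((h.hx t).mul (h.hy t)).div_const (a * (1 + a))).add
    (hl.mul (((h.hx t).pow 2).sub_const (a * (1 + a))))).sub (hasDerivAt_id t)).add
    ((h.hz t).const_mul 2)).div_const (1 + 2 * a)
  refine hda this (fun s => by rfl) ?_
  have he := h.energy t
  simp only [Vx, Pi.add_apply, Pi.pow_apply, id]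
  push_cast
  generalize x t = X at *
  generalize y t = Y at *
  generalize z t = Z at *
  have h1 : 1 + a ≠ 0 := fun h => hg (by rw [h, mul_zero])
  have h2 : a ≠ 0 := fun h => hg (by rw [h, zero_mul])
  field_simp
  simp only [Nat.add_one_sub_one, pow_one] at *
  linear_combination (-1) * he

lemma hd_of_sq (f : ℝ → ℝ) (a d C : ℝ)
    (h : ∀ᶠ b in nhds a, (f b - f a - (b - a) * d) ^ 2 ≤ C * (b - a) ^ 4) :
    HasDerivAt f d a := by
  rw [hasDerivAt_iff_isLittleO]
  have h1 : (fun b => f b - f a - (b - a) • d) =O[nhds a] fun b => (b - a) ^ 2 := by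
    apply Asymptotics.IsBigO.of_bound (Real.sqrt C)
    filter_upwards [h] with b hb
    rw [smul_eq_mul, Real.norm_eq_abs, Real.norm_eq_abs]
    calc |f b - f a - (b - a) * d| = Real.sqrt ((f b - f a - (b - a) * d) ^ 2) :=
          (Real.sqrt_sq_eq_abs _).symm
      _ ≤ Real.sqrt (C * (b - a) ^ 4) := Real.sqrt_le_sqrt hb
      _ = Real.sqrt C * |(b - a) ^ 2| := by
          rw [Real.sqrt_mul' _ (by positivity), ← Real.sqrt_sq_eq_abs]
          ring_nf
  refine h1.trans_isLittleO ?_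
  have h2 : (fun b : ℝ => b - a) =o[nhds a] fun _ => (1 : ℝ) := by
    rw [Asymptotics.isLittleO_one_iff]
    have : Filter.Tendsto (fun b : ℝ => b - a) (nhds a) (nhds (a - a)) :=
      (continuous_id.sub continuous_const).tendsto a
    simpa using this
  have h3 := h2.mul_isBigO (Asymptotics.isBigO_refl (fun b : ℝ => b - a) (nhds a))
  simpa [sq] using h3

lemma bound_A (g u ξ B : ℝ) (hg : |g| ≤ B) (hu : |u| ≤ B) (hξ : |ξ| ≤ 2 * B) :
    |1 + 2 * g - 2 * (u ^ 2 + u * ξ + ξ ^ 2)| ≤ 1 + 5 * B + 15 * B ^ 2 := by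
  have hB : 0 ≤ B := (abs_nonneg _).trans hg
  have h1 := sq_le_sq' (abs_le.1 hu).1 (abs_le.1 hu).2
  have h2 := sq_le_sq' (abs_le.1 hξ).1 (abs_le.1 hξ).2
  obtain ⟨g1, g2⟩ := abs_le.1 hg
  rw [abs_le]
  constructor <;> nlinarith [sq_nonneg (u - ξ), sq_nonneg (u + ξ)]

lemma bound_R (a X V h B : ℝ) (hX : |X| ≤ B) (hV : |V| ≤ B) (hh : |h| ≤ 1) :
    |h ^ 2 * (2 * (1 + 2 * a) * V + 2 * X + 2 * h * V - 6 * X * V ^ 2 - 2 * h * V ^ 3)|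
      ≤ (2 * |1 + 2 * a| * B + 4 * B + 8 * B ^ 3 + B ^ 2 + 1) * h ^ 2 := by
  have hB : 0 ≤ B := (abs_nonneg _).trans hV
  rw [abs_mul, abs_of_nonneg (sq_nonneg h), mul_comm]
  refine mul_le_mul_of_nonneg_right ?_ (sq_nonneg h)
  have e1 : |2 * (1 + 2 * a) * V| ≤ 2 * |1 + 2 * a| * B := by
    rw [abs_mul, abs_mul, abs_two]; gcongr
  have e2 : |2 * X| ≤ 2 * B := by rw [abs_mul, abs_two]; gcongr
  have e3 : |2 * h * V| ≤ 2 * 1 * B := by rw [abs_mul, abs_mul, abs_two]; gcongr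
  have e4 : |6 * X * V ^ 2| ≤ 6 * B * B ^ 2 := by
    rw [abs_mul, abs_mul, abs_pow, abs_of_pos (by norm_num : (0:ℝ) < 6)]; gcongr
  have e5 : |2 * h * V ^ 3| ≤ 2 * 1 * B ^ 3 := by
    rw [abs_mul, abs_mul, abs_pow, abs_two]; gcongr
  rw [abs_le] at *
  constructor <;> nlinarith [sq_nonneg B]

lemma param (x y z : ℝ → ℝ → ℝ) (hS : ∀ a, -(1/2 : ℝ) ≤ a → a ≠ 0 → Sol a (x a) (y a) (z a))
    (a : ℝ) (ha : -(1/2 : ℝ) < a) (ha0 : a ≠ 0) (T : ℝ) (hT : 0 ≤ T) :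
    ∃ C : ℝ, ∀ b, -(1/2 : ℝ) ≤ b → b ≠ 0 → |b - a| ≤ 1 → ∀ t, |t| ≤ T →
      (x b t - x a t - (b - a) * Vx a t (x a t) (y a t) (z a t)) ^ 2
      + (y b t - y a t - (b - a) * Vy a t (x a t) (y a t) (z a t)) ^ 2
      + (z b t - z a t - (b - a) * Vz a t (x a t) (y a t) (z a t)) ^ 2 ≤ C * (b - a) ^ 4 := by
  have h := hS a ha.le ha0
  have ha1 : 1 + a ≠ 0 := by linarith
  have hg : a * (1 + a) ≠ 0 := mul_ne_zero ha0 ha1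
  have ha2 : 1 + 2 * a ≠ 0 := by linarith
  set V := fun t => Vx a t (x a t) (y a t) (z a t) with hVdef
  obtain ⟨B0, hB0⟩ : ∃ B0, ∀ t, |t| ≤ T → |V t| ≤ B0 := by
    obtain ⟨B0, hB0⟩ := (isCompact_Icc (a := -T) (b := T)).exists_bound_of_continuousOn
      (f := V) (fun t _ => (h.dVx t).continuousAt.continuousWithinAt)
    exact ⟨B0, fun t ht => hB0 t (abs_le.1 ht)⟩
  set B := |B0| + 1 + (|a| + 1) * (|a| + 2) with hB
  have hBγ : ∀ b, |b - a| ≤ 1 → |b * (1 + b)| ≤ (|a| + 1) * (|a| + 2) := by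
    intro b hb
    have h1 : |b| ≤ |a| + 1 := by
      have := abs_add_le (b - a) a
      rw [sub_add_cancel] at this; linarith
    have h2 : |1 + b| ≤ |a| + 2 := by
      have := abs_add_le 1 b
      rw [abs_one] at this; linarith
    rw [abs_mul]; gcongr
  have hBx : ∀ b, -(1/2 : ℝ) ≤ b → b ≠ 0 → |b - a| ≤ 1 → ∀ t, |x b t| ≤ B := by
    intro b h1 h2 h3 t
    have := (hS b h1 h2).bound t
    have := hBγ b h3
    have := abs_nonneg B0
    linarith
  have hBV : ∀ t, |t| ≤ T → |V t| ≤ B := by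
    intro t ht
    have := hB0 t ht
    have := le_abs_self B0
    have : 0 ≤ (|a| + 1) * (|a| + 2) := by positivity
    linarith
  have hBp : 0 ≤ B := by positivity
  set E := 2 * |1 + 2 * a| * B + 4 * B + 8 * B ^ 3 + B ^ 2 + 1 with hE
  refine ⟨2 * E ^ 2 * (1 + T) * Real.exp ((2 * (1 + 5 * B + 15 * B ^ 2) + 2) * T), ?_⟩
  intro b hb hb0 hba t ht
  have h' := hS b hb hb0
  have hξ : ∀ t, |t| ≤ T → |x a t + (b - a) * V t| ≤ 2 * B := by
    intro t ht
    have h1 := abs_add_le (x a t) ((b - a) * V t)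
    have h2 := hBx a ha.le ha0 (by simp) t
    have h3 : |(b - a) * V t| ≤ 1 * B := by
      rw [abs_mul]; gcongr; exact hBV t ht
    linarith
  have key := stab (fun t => x b t - x a t - (b - a) * V t)
    (fun t => y b t - y a t - (b - a) * Vy a t (x a t) (y a t) (z a t))
    (fun t => z b t - z a t - (b - a) * Vz a t (x a t) (y a t) (z a t))
    (fun t => 1 + 2 * (b * (1 + b)) - 2 * (x b t ^ 2 + x b t * (x a t + (b - a) * V t)
      + (x a t + (b - a) * V t) ^ 2))
    (fun t => x b t + (x a t + (b - a) * V t))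
    (fun t => (b - a) ^ 2 * (2 * (1 + 2 * a) * V t + 2 * x a t + 2 * (b - a) * V t
      - 6 * x a t * V t ^ 2 - 2 * (b - a) * V t ^ 3))
    (fun t => (b - a) ^ 2 * (V t ^ 2 - 1))
    T (1 + 5 * B + 15 * B ^ 2) (E * (b - a) ^ 2) hT
    (fun t => ((h'.hx t).sub (h.hx t)).sub ((h.dVx t).const_mul (b - a)))
    (fun t => hda (((h'.hy t).sub (h.hy t)).sub ((h.dVy t hg ha2).const_mul (b - a)))
      (fun s => by rfl) (by simp only [hVdef]; ring))
    (fun t => hda (((h'.hz t).sub (h.hz t)).sub ((h.dVz t hg ha2).const_mul (b - a)))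
      (fun s => by rfl) (by simp only [hVdef]; ring))
    (fun t ht => by
      refine bound_A _ _ _ B ?_ (hBx b hb hb0 hba t) (hξ t ht)
      have := hBγ b hba
      have := abs_nonneg B0
      linarith)
    (fun t ht => by
      have h1 := abs_add_le (x b t) (x a t + (b - a) * V t)
      have h2 := hξ t ht
      have h3 := hBx b hb hb0 hba t
      nlinarith)
    (fun t ht => bound_R a _ _ _ B (hBx a ha.le ha0 (by simp) t) (hBV t ht) hba)
    (fun t ht => by
      rw [abs_mul, abs_of_nonneg (sq_nonneg (b - a)), mul_comm]
      refine mul_le_mul_of_nonneg_right ?_ (sq_nonneg _)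
      have h1 := hBV t ht
      have h2 := sq_le_sq' (abs_le.1 h1).1 (abs_le.1 h1).2
      have h3 : 0 ≤ 2 * |1 + 2 * a| * B + 4 * B + 8 * B ^ 3 := by positivity
      rw [abs_le]
      constructor <;> nlinarith [sq_nonneg (V t)])
    (by
      have e1 : V 0 = 1 := by
        simp only [hVdef, Vx, h.x0, h.y0, h.z0]
        rw [div_eq_iff ha2]
        field_simp
        ring
      have e2 : Vy a 0 (x a 0) (y a 0) (z a 0) = 0 := by
        simp [Vy, h.y0, h.z0]
      have e3 : Vz a 0 (x a 0) (y a 0) (z a 0) = 0 := by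
        simp [Vz, h.y0, h.z0]
      simp only [e1, e2, e3]
      simp only [h.x0, h.y0, h.z0, h'.x0, h'.y0, h'.z0]
      have : 0 ≤ (E * (b - a) ^ 2) ^ 2 := sq_nonneg _
      linarith [this, show (1 + b - (1 + a) - (b - a) * 1) ^ 2 + (0 - 0 - (b - a) * 0) ^ 2
        + (0 - 0 - (b - a) * 0) ^ 2 = 0 by ring])
    t ht
  refine key.trans (le_of_eq ?_)
  ring

lemma param_deriv (x y z : ℝ → ℝ → ℝ)
    (hS : ∀ a, -(1/2 : ℝ) ≤ a → a ≠ 0 → Sol a (x a) (y a) (z a))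
    (a : ℝ) (ha : -(1/2 : ℝ) < a) (ha0 : a ≠ 0) (t : ℝ) :
    HasDerivAt (fun b => x b t) (Vx a t (x a t) (y a t) (z a t)) a ∧
    HasDerivAt (fun b => z b t) (Vz a t (x a t) (y a t) (z a t)) a := by
  obtain ⟨C, hC⟩ := param x y z hS a ha ha0 |t| (abs_nonneg t)
  have hev : ∀ᶠ b in nhds a, -(1/2 : ℝ) ≤ b ∧ b ≠ 0 ∧ |b - a| ≤ 1 := by
    have h1 : ∀ᶠ b in nhds a, -(1/2 : ℝ) < b := lt_mem_nhds ha
    have h2 : ∀ᶠ b in nhds a, b ≠ 0 := isOpen_ne.mem_nhds ha0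
    have h3 : ∀ᶠ b in nhds a, b ∈ Metric.closedBall a 1 :=
      Metric.closedBall_mem_nhds a one_pos
    filter_upwards [h1, h2, h3] with b b1 b2 b3
    exact ⟨b1.le, b2, by simpa [Real.dist_eq] using b3⟩
  constructor
  · apply hd_of_sq _ _ _ C
    filter_upwards [hev] with b hb
    have := hC b hb.1 hb.2.1 hb.2.2 t le_rfl
    nlinarith [sq_nonneg (y b t - y a t - (b - a) * Vy a t (x a t) (y a t) (z a t)),
      sq_nonneg (z b t - z a t - (b - a) * Vz a t (x a t) (y a t) (z a t))]
  · apply hd_of_sq _ _ _ C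
    filter_upwards [hev] with b hb
    have := hC b hb.1 hb.2.1 hb.2.2 t le_rfl
    nlinarith [sq_nonneg (y b t - y a t - (b - a) * Vy a t (x a t) (y a t) (z a t)),
      sq_nonneg (x b t - x a t - (b - a) * Vx a t (x a t) (y a t) (z a t))]

lemma W_eq (a t x y z : ℝ) (hg : a * (1 + a) ≠ 0) (ha : 1 + 2 * a ≠ 0) (hx : x ≠ 0)
    (he : y ^ 2 = x ^ 2 - (x ^ 2 - a * (1 + a)) ^ 2) :
    -((x ^ 2 - a * (1 + a)) / x) * Vx a t x y z + (y / x) * Vz a t x y z = W0 a t x y z := by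
  have h1 : 1 + a ≠ 0 := fun h => hg (by rw [h, mul_zero])
  have h2 : a ≠ 0 := fun h => hg (by rw [h, zero_mul])
  simp only [Vx, Vz, W0]
  generalize 1 + 2 * a = c at *
  field_simp
  linear_combination x * he

lemma conv_sech (T : ℝ) (hT : 0 ≤ T) : ∃ C : ℝ, ∀ (a : ℝ) (x y z : ℝ → ℝ), |a| ≤ 1 / 4 →
    Sol a x y z → ∀ t, |t| ≤ T →
    (x t - 1 / Real.cosh t) ^ 2 + (y t - -Real.sinh t / Real.cosh t ^ 2) ^ 2
      + (z t - Real.tanh t) ^ 2 ≤ C * a ^ 2 := by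
  refine ⟨2 * 8 ^ 2 * (1 + T) * Real.exp ((2 * 100 + 2) * T), ?_⟩
  intro a x y z ha h t ht
  have h0 := sol_sech
  have hγ : |a * (1 + a)| ≤ 2 * |a| := by
    rw [abs_mul, mul_comm]
    have := abs_add_le 1 a
    rw [abs_one] at this
    exact mul_le_mul_of_nonneg_right (by linarith) (abs_nonneg _)
  have hxb : ∀ t, |x t| ≤ 2 := fun t => by
    have := h.bound t
    linarith
  have hx0b : ∀ t, |1 / Real.cosh t| ≤ 2 := fun t => by
    have := h0.bound t
    simp only [zero_mul, abs_zero] at this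
    linarith
  have key := stab (fun t => x t - 1 / Real.cosh t)
    (fun t => y t - -Real.sinh t / Real.cosh t ^ 2) (fun t => z t - Real.tanh t)
    (fun t => 1 + 2 * 0 - 2 * (x t ^ 2 + x t * (1 / Real.cosh t) + (1 / Real.cosh t) ^ 2))
    (fun t => x t + 1 / Real.cosh t) (fun t => 2 * (a * (1 + a)) * x t)
    (fun t => -(a * (1 + a))) T 100 (8 * |a|) hT
    (fun t => (h.hx t).sub (h0.hx t))
    (fun t => hda ((h.hy t).sub (h0.hy t)) (fun s => by rfl) (by ring))
    (fun t => hda ((h.hz t).sub (h0.hz t)) (fun s => by rfl) (by ring))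
    (fun t ht => (bound_A 0 _ _ 2 (by norm_num) (hxb t) ((hx0b t).trans (by norm_num))).trans
      (by norm_num))
    (fun t ht => (abs_add_le _ _).trans (by linarith [hxb t, hx0b t]))
    (fun t ht => by
      rw [abs_mul, abs_mul, abs_two]
      have := mul_le_mul hγ (hxb t) (abs_nonneg _) (by positivity)
      linarith)
    (fun t ht => by
      rw [abs_neg]
      linarith [abs_nonneg a])
    (by
      simp only [h.x0, h.y0, h.z0, Real.cosh_zero, Real.sinh_zero, Real.tanh_zero]
      rw [mul_pow, sq_abs]
      nlinarith [sq_nonneg a])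
    t ht
  refine key.trans (le_of_eq ?_)
  rw [mul_pow, sq_abs]
  ring

lemma w0_eq (t : ℝ) : -1 + t * Real.tanh t
    = W0 0 t (1 / Real.cosh t) (-Real.sinh t / Real.cosh t ^ 2) (Real.tanh t) := by
  have hc := (Real.cosh_pos t).ne'
  have := Real.cosh_sq t
  simp only [W0, Real.tanh_eq_sinh_div_cosh]
  field_simp
  linear_combination (-2) * this

lemma tube (M η : ℝ) (hη : 0 < η) : ∃ d > 0, ∀ a r ρ s : ℝ, |a| < d → |r| < d →
    |ρ| < d → |s| < d → ∀ t, |t| ≤ M →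
    |W0 a t (1 / Real.cosh t + r) (-Real.sinh t / Real.cosh t ^ 2 + ρ) (Real.tanh t + s)
      - W0 0 t (1 / Real.cosh t) (-Real.sinh t / Real.cosh t ^ 2) (Real.tanh t)|
    + |W1 a t (1 / Real.cosh t + r) (-Real.sinh t / Real.cosh t ^ 2 + ρ) (Real.tanh t + s)
      - W1 0 t (1 / Real.cosh t) (-Real.sinh t / Real.cosh t ^ 2) (Real.tanh t)|
    + |W2 a t (1 / Real.cosh t + r) (-Real.sinh t / Real.cosh t ^ 2 + ρ) (Real.tanh t + s)
      - W2 0 t (1 / Real.cosh t) (-Real.sinh t / Real.cosh t ^ 2) (Real.tanh t)| ≤ η := by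
  let P : (ℝ × ℝ × ℝ × ℝ) → ℝ → Prop := fun p t =>
    |W0 p.1 t (1 / Real.cosh t + p.2.1) (-Real.sinh t / Real.cosh t ^ 2 + p.2.2.1)
        (Real.tanh t + p.2.2.2)
      - W0 0 t (1 / Real.cosh t) (-Real.sinh t / Real.cosh t ^ 2) (Real.tanh t)|
    + |W1 p.1 t (1 / Real.cosh t + p.2.1) (-Real.sinh t / Real.cosh t ^ 2 + p.2.2.1)
        (Real.tanh t + p.2.2.2)
      - W1 0 t (1 / Real.cosh t) (-Real.sinh t / Real.cosh t ^ 2) (Real.tanh t)|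
    + |W2 p.1 t (1 / Real.cosh t + p.2.1) (-Real.sinh t / Real.cosh t ^ 2 + p.2.2.1)
        (Real.tanh t + p.2.2.2)
      - W2 0 t (1 / Real.cosh t) (-Real.sinh t / Real.cosh t ^ 2) (Real.tanh t)| < η
  have hth : Continuous Real.tanh := by
    have h2 : Real.tanh = fun t => Real.sinh t / Real.cosh t := by
      funext t; exact Real.tanh_eq_sinh_div_cosh t
    rw [h2]
    exact Real.continuous_sinh.div Real.continuous_cosh (fun t => (Real.cosh_pos t).ne')
  have hc1 : Continuous fun t => 1 / Real.cosh t :=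
    continuous_const.div Real.continuous_cosh (fun t => (Real.cosh_pos t).ne')
  have hc2 : Continuous fun t => -Real.sinh t / Real.cosh t ^ 2 :=
    Real.continuous_sinh.neg.div (Real.continuous_cosh.pow 2)
      (fun t => pow_ne_zero 2 (Real.cosh_pos t).ne')
  have hall : ∀ᶠ p in nhds (0 : ℝ × ℝ × ℝ × ℝ), ∀ t ∈ Set.Icc (-M) M, P p t := by
    apply isCompact_Icc.eventually_forall_of_forall_eventually
    intro t _
    have hc0 : (1 / Real.cosh t) ≠ 0 := by
      have := Real.cosh_pos t
      positivity
    have a1 : ContinuousAt (fun q : (ℝ × ℝ × ℝ × ℝ) × ℝ => 1 / Real.cosh q.2 + q.1.2.1) (0, t) :=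
      ((hc1.comp continuous_snd).add (by fun_prop)).continuousAt
    have a2 : ContinuousAt (fun q : (ℝ × ℝ × ℝ × ℝ) × ℝ =>
        -Real.sinh q.2 / Real.cosh q.2 ^ 2 + q.1.2.2.1) (0, t) :=
      ((hc2.comp continuous_snd).add (by fun_prop)).continuousAt
    have a3 : ContinuousAt (fun q : (ℝ × ℝ × ℝ × ℝ) × ℝ =>
        Real.tanh q.2 + q.1.2.2.2) (0, t) :=
      ((hth.comp continuous_snd).add (by fun_prop)).continuousAt
    have b1 : ContinuousAt (fun q : (ℝ × ℝ × ℝ × ℝ) × ℝ => 1 / Real.cosh q.2) (0, t) :=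
      (hc1.comp continuous_snd).continuousAt
    have b2 : ContinuousAt (fun q : (ℝ × ℝ × ℝ × ℝ) × ℝ =>
        -Real.sinh q.2 / Real.cosh q.2 ^ 2) (0, t) :=
      (hc2.comp continuous_snd).continuousAt
    have b3 : ContinuousAt (fun q : (ℝ × ℝ × ℝ × ℝ) × ℝ => Real.tanh q.2) (0, t) :=
      (hth.comp continuous_snd).continuousAt
    have ca : ContinuousAt (fun q : (ℝ × ℝ × ℝ × ℝ) × ℝ => q.1.1) (0, t) := by fun_prop
    have ct : ContinuousAt (fun q : (ℝ × ℝ × ℝ × ℝ) × ℝ => q.2) (0, t) := by fun_prop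
    have cz : ContinuousAt (fun q : (ℝ × ℝ × ℝ × ℝ) × ℝ => (0 : ℝ)) (0, t) := by fun_prop
    have gW : ∀ f1 f2 f3 f4 f5 : (ℝ × ℝ × ℝ × ℝ) × ℝ → ℝ, ContinuousAt f1 (0, t) →
        ContinuousAt f2 (0, t) → ContinuousAt f3 (0, t) → ContinuousAt f4 (0, t) →
        ContinuousAt f5 (0, t) → f1 (0, t) = 0 → f3 (0, t) ≠ 0 →
        ContinuousAt (fun q => W0 (f1 q) (f2 q) (f3 q) (f4 q) (f5 q)) (0, t) ∧
        ContinuousAt (fun q => W1 (f1 q) (f2 q) (f3 q) (f4 q) (f5 q)) (0, t) ∧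
        ContinuousAt (fun q => W2 (f1 q) (f2 q) (f3 q) (f4 q) (f5 q)) (0, t) := by
      intro f1 f2 f3 f4 f5 h1 h2 h3 h4 h5 hz hn
      have hn1 : 1 + 2 * f1 (0, t) ≠ 0 := by rw [hz]; norm_num
      have hn2 : f3 (0, t) ^ 2 ≠ 0 := pow_ne_zero 2 hn
      refine ⟨?_, ?_, ?_⟩
      · unfold W0; fun_prop (disch := assumption)
      · unfold W1; fun_prop (disch := assumption)
      · unfold W2 W0; fun_prop (disch := assumption)
    obtain ⟨c0, c1, c2⟩ := gW _ _ _ _ _ ca ct a1 a2 a3 rfl (by simpa using hc0)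
    obtain ⟨d0, d1, d2⟩ := gW _ _ _ _ _ cz ct b1 b2 b3 rfl (by simpa using hc0)
    have hcont := (((c0.sub d0).abs).add ((c1.sub d1).abs)).add ((c2.sub d2).abs)
    have hlt := hcont.eventually_lt (continuousAt_const (y := η)) (by simpa using hη)
    exact hlt
  rw [Metric.eventually_nhds_iff] at hall
  obtain ⟨d, hd, hP⟩ := hall
  refine ⟨d, hd, fun a r ρ s ha hr hρ hs t ht => ?_⟩
  have := hP (y := (a, r, ρ, s)) (by
    simp only [dist_zero_right, Prod.norm_def, Real.norm_eq_abs]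
    simp [ha, hr, hρ, hs]) t (abs_le.1 ht)
  exact this.le

/-- Singular limit of the Delaunay Jacobi field: w_{a,0}^+ → −1 + t·tanh t in
C²_loc(ℝ) as a → 0, together with the uniform linear bound |w_{a,0}^+(t)| ≤ C(1 + |t|). -/
theorem singular_limit_jacobi_field
    (x x' z : ℝ → ℝ → ℝ)
    (hx : ∀ a, -(1/2 : ℝ) ≤ a → a ≠ 0 → ∀ t, HasDerivAt (x a) (x' a t) t)
    (hx' : ∀ a, -(1/2 : ℝ) ≤ a → a ≠ 0 → ∀ t,
      HasDerivAt (x' a) ((1 + 2 * (a * (1 + a))) * x a t - 2 * x a t ^ 3) t)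
    (hx0 : ∀ a, -(1/2 : ℝ) ≤ a → a ≠ 0 → x a 0 = 1 + a)
    (hx'0 : ∀ a, -(1/2 : ℝ) ≤ a → a ≠ 0 → x' a 0 = 0)
    (hz : ∀ a, -(1/2 : ℝ) ≤ a → a ≠ 0 → ∀ t,
      HasDerivAt (z a) (x a t ^ 2 - a * (1 + a)) t)
    (hz0 : ∀ a, -(1/2 : ℝ) ≤ a → a ≠ 0 → z a 0 = 0)
    -- differentiability of the family with respect to the Delaunay parameter on (−1/2,∞)∖{0}
    (dx dz : ℝ → ℝ → ℝ)
    (hdx : ∀ a, -(1/2 : ℝ) < a → a ≠ 0 → ∀ t, HasDerivAt (fun b => x b t) (dx a t) a)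
    (hdz : ∀ a, -(1/2 : ℝ) < a → a ≠ 0 → ∀ t, HasDerivAt (fun b => z b t) (dz a t) a) :
    -- C²_loc convergence to w₀(t) = −1 + t tanh t
    (∀ M η : ℝ, 0 < M → 0 < η → ∃ δ : ℝ, 0 < δ ∧ ∀ a : ℝ, a ≠ 0 → |a| < δ →
      ∀ t : ℝ, |t| ≤ M →
        |wplus x x' dx dz a t - (-1 + t * Real.tanh t)|
          + |deriv (wplus x x' dx dz a) t - deriv (fun s : ℝ => -1 + s * Real.tanh s) t|
          + |deriv (deriv (wplus x x' dx dz a)) t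
              - deriv (deriv (fun s : ℝ => -1 + s * Real.tanh s)) t| ≤ η) ∧
    -- uniform linear growth bound
    (∀ a₀ : ℝ, 0 < a₀ → a₀ < 1/2 → ∃ C : ℝ, 0 < C ∧
      ∀ a : ℝ, a ≠ 0 → |a| ≤ a₀ → ∀ t : ℝ,
        |wplus x x' dx dz a t| ≤ C * (1 + |t|)) := by
  have hS : ∀ a, -(1/2 : ℝ) ≤ a → a ≠ 0 → Sol a (x a) (x' a) (z a) := fun a h1 h2 =>
    ⟨hx a h1 h2, hx' a h1 h2, hz a h1 h2, hx0 a h1 h2, hx'0 a h1 h2, hz0 a h1 h2⟩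
  have hne : ∀ a, -(1/2 : ℝ) < a → a ≠ 0 → ∀ t, x a t ≠ 0 := fun a h1 h2 t =>
    (hS a h1.le h2).ne (mul_ne_zero h2 (by linarith)) t
  have hW : ∀ a, -(1/2 : ℝ) < a → a ≠ 0 →
      wplus x x' dx dz a = fun t => W0 a t (x a t) (x' a t) (z a t) := by
    intro a h1 h2
    funext t
    obtain ⟨p1, p2⟩ := param_deriv x x' z hS a h1 h2 t
    have e1 := (hdx a h1 h2 t).unique p1
    have e2 := (hdz a h1 h2 t).unique p2
    simp only [wplus]
    rw [e1, e2]
    exact W_eq a t _ _ _ (mul_ne_zero h2 (by linarith)) (by linarith) (hne a h1 h2 t)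
      ((hS a h1.le h2).energy t)
  constructor
  · intro M η hM hη
    obtain ⟨d, hd, hP⟩ := tube M η hη
    obtain ⟨C, hC⟩ := conv_sech M hM.le
    have hs : 0 < d / (|C| + 1) := by positivity
    refine ⟨min (min (1 / 4) 1) (min d (d / (|C| + 1))), by positivity, ?_⟩
    intro a ha0 ha t ht
    simp only [lt_min_iff] at ha
    obtain ⟨⟨h4, -⟩, had, hac⟩ := ha
    have ha2 : -(1/2 : ℝ) < a := by linarith [(abs_lt.1 h4).1]
    have hsol := hS a ha2.le ha0
    have hb := hC a _ _ _ h4.le hsol t ht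
    have hlt : C * a ^ 2 < d ^ 2 := by
      rw [lt_div_iff₀ (by positivity)] at hac
      have k1 : (|a| * (|C| + 1)) ^ 2 < d ^ 2 := by
        apply pow_lt_pow_left₀ hac (by positivity) (by norm_num)
      have k2 : C * a ^ 2 ≤ (|a| * (|C| + 1)) ^ 2 := by
        rw [mul_pow, sq_abs, mul_comm]
        apply mul_le_mul_of_nonneg_left _ (sq_nonneg a)
        nlinarith [le_abs_self C, abs_nonneg C]
      linarith
    have q1 : |x a t - 1 / Real.cosh t| < d := abs_lt_of_sq_lt_sq (by
      nlinarith [sq_nonneg (x' a t - -Real.sinh t / Real.cosh t ^ 2),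
        sq_nonneg (z a t - Real.tanh t)]) hd.le
    have q2 : |x' a t - -Real.sinh t / Real.cosh t ^ 2| < d := abs_lt_of_sq_lt_sq (by
      nlinarith [sq_nonneg (x a t - 1 / Real.cosh t),
        sq_nonneg (z a t - Real.tanh t)]) hd.le
    have q3 : |z a t - Real.tanh t| < d := abs_lt_of_sq_lt_sq (by
      nlinarith [sq_nonneg (x' a t - -Real.sinh t / Real.cosh t ^ 2),
        sq_nonneg (x a t - 1 / Real.cosh t)]) hd.le
    have hfin := hP a _ _ _ had q1 q2 q3 t ht
    simp only [add_sub_cancel] at hfin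
    have dW : deriv (wplus x x' dx dz a) = fun t => W1 a t (x a t) (x' a t) (z a t) := by
      rw [hW a ha2 ha0]
      funext t
      exact (hsol.dW0 t (hne a ha2 ha0 t)).deriv
    have ddW : deriv (deriv (wplus x x' dx dz a)) = fun t => W2 a t (x a t) (x' a t) (z a t) := by
      rw [dW]
      funext t
      exact (hsol.dW1 t (hne a ha2 ha0 t) (by linarith)).deriv
    have hcn : ∀ t, 1 / Real.cosh t ≠ 0 := fun t => by
      have := Real.cosh_pos t
      positivity
    have w0 : (fun s : ℝ => -1 + s * Real.tanh s) = fun t => W0 0 t (1 / Real.cosh t)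
        (-Real.sinh t / Real.cosh t ^ 2) (Real.tanh t) := funext w0_eq
    have dw0 : deriv (fun s : ℝ => -1 + s * Real.tanh s) = fun t => W1 0 t (1 / Real.cosh t)
        (-Real.sinh t / Real.cosh t ^ 2) (Real.tanh t) := by
      rw [w0]
      funext t
      exact (sol_sech.dW0 t (hcn t)).deriv
    have ddw0 : deriv (deriv (fun s : ℝ => -1 + s * Real.tanh s)) = fun t =>
        W2 0 t (1 / Real.cosh t) (-Real.sinh t / Real.cosh t ^ 2) (Real.tanh t) := by
      rw [dw0]
      funext t
      exact (sol_sech.dW1 t (hcn t) (by norm_num)).deriv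
    rw [ddW, dW, ddw0, dw0, hW a ha2 ha0, w0_eq t]
    exact hfin
  · intro a₀ h0 h1
    have hpos : 0 < 1 - 2 * a₀ := by linarith
    refine ⟨11 / (1 - 2 * a₀), by positivity, ?_⟩
    intro a ha0 ha t
    have hal := abs_le.1 ha
    have ha2 : -(1/2 : ℝ) < a := by linarith
    have hsol := hS a ha2.le ha0
    have hγ : |a * (1 + a)| ≤ 1 := by
      rw [abs_le]; constructor <;> nlinarith
    have hxb : ∀ t, |x a t| ≤ 2 := fun t => by linarith [hsol.bound t]
    have hz' : ∀ t, |x a t ^ 2 - a * (1 + a)| ≤ |x a t| := fun t =>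
      sq_le_sq.1 (by nlinarith [sq_nonneg (x' a t), hsol.energy t])
    have hy' : |x' a t| ≤ |x a t| :=
      sq_le_sq.1 (by nlinarith [sq_nonneg (x a t ^ 2 - a * (1 + a)), hsol.energy t])
    have hφ : |x' a t / x a t| ≤ 1 := by
      rw [abs_div]
      exact div_le_one_of_le₀ hy' (abs_nonneg _)
    have hzb : |z a t| ≤ 2 * |t| := by
      have := Convex.norm_image_sub_le_of_norm_hasDerivWithin_le (f := z a)
        (f' := fun t => x a t ^ 2 - a * (1 + a)) (C := 2) (s := Set.univ) (x := 0) (y := t)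
        (fun s _ => (hsol.hz s).hasDerivWithinAt)
        (fun s _ => (hz' s).trans (hxb s)) convex_univ (Set.mem_univ _) (Set.mem_univ _)
      simpa [hsol.z0] using this
    rw [hW a ha2 ha0]
    simp only [W0]
    have hp : 0 < 1 + 2 * a := by linarith
    rw [abs_div, abs_of_pos hp, div_le_iff₀ hp]
    have hnum : |1 + 2 * (a * (1 + a)) - 2 * x a t ^ 2 + (2 * z a t - t) * (x' a t / x a t)|
        ≤ 11 * (1 + |t|) := by
      have e1 : |(2 * z a t - t) * (x' a t / x a t)| ≤ 5 * |t| * 1 := by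
        rw [abs_mul]
        have : |2 * z a t - t| ≤ 5 * |t| := by
          have := abs_sub (2 * z a t) t
          rw [abs_mul, abs_two] at this
          linarith
        gcongr
      have e2 : x a t ^ 2 ≤ 2 ^ 2 := sq_le_sq' (abs_le.1 (hxb t)).1 (abs_le.1 (hxb t)).2
      have e3 := abs_nonneg t
      rw [abs_le] at *
      constructor <;> nlinarith [sq_nonneg (x a t)]
    refine hnum.trans ?_
    have : 11 / (1 - 2 * a₀) * (1 + |t|) * (1 + 2 * a)
        = 11 * (1 + |t|) * ((1 + 2 * a) / (1 - 2 * a₀)) := by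
      field_simp
    rw [this]
    apply le_mul_of_one_le_right (by positivity)
    rw [one_le_div hpos]
    linarith
end Delaunay
end
end

section
/- Orthogonality relations for the limiting Jacobi operator. Define 𝓛₀φ := Δφ + 2(sech t)²φ for φ ∈ C²(ℝ²), where Δ = ∂_tt + ∂_θθ. Let φ ∈ C²(ℝ²) be 2π-periodic in θ and satisfy sup_{(t,θ)∈ℝ×[−π,π]} cosh(t)·(|φ(t,θ)| + |∇φ(t,θ)| + |D²φ(t,θ)|) < ∞. Then for every w in the set { (t,θ) ↦ −1 + t·tanh t, (t,θ) ↦ −tanh t, (t,θ) ↦ sech t · cos θ, (t,θ) ↦ sech t · sin θ } one has ∫_{ℝ×[−π,π]} w(t,θ)·𝓛₀φ(t,θ) dt dθ = 0 (the integral being absolutely convergent). -/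
noncomputable section

namespace Delaunay

lemma aux_weight (t : ℝ) : (1 + |t|) * (Real.cosh t)⁻¹ ≤ 32 * (1 + t ^ 2)⁻¹ := by
  have hc : Real.exp |t| / 2 ≤ Real.cosh t := by
    rw [← Real.cosh_abs, Real.cosh_eq]
    have := Real.exp_pos (-|t|)
    linarith
  have h0 : 0 ≤ |t| := abs_nonneg t
  have h1 : 1 + |t| / 2 + (|t| / 2) ^ 2 / 2 ≤ Real.exp (|t| / 2) :=
    Real.quadratic_le_exp_of_nonneg (by positivity)
  have h2 : Real.exp |t| = Real.exp (|t| / 2) * Real.exp (|t| / 2) := by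
    rw [← Real.exp_add]; ring_nf
  have hsq : t ^ 2 = |t| ^ 2 := (sq_abs t).symm
  have hcp := Real.cosh_pos t
  have key : (1 + |t|) * (1 + t ^ 2) ≤ 32 * Real.cosh t := by
    have ha : 1 + |t| ≤ 2 * Real.exp (|t| / 2) := by nlinarith [sq_nonneg |t|]
    have hb : 1 + t ^ 2 ≤ 8 * Real.exp (|t| / 2) := by rw [hsq]; nlinarith [sq_nonneg |t|]
    have := mul_le_mul ha hb (by positivity) (by positivity)
    nlinarith
  rw [← div_eq_mul_inv, ← div_eq_mul_inv, div_le_div_iff₀ hcp (by positivity)]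
  exact key

lemma aux_mul {a b t K M : ℝ} (ha : |a| ≤ K * (1 + |t|)) (hK : 0 ≤ K)
    (hb : |b| ≤ M * (Real.cosh t)⁻¹) : |a * b| ≤ K * M * 32 * (1 + t ^ 2)⁻¹ := by
  have hcp := Real.cosh_pos t
  have hM : 0 ≤ M := by
    have h : 0 ≤ M * (Real.cosh t)⁻¹ := (abs_nonneg b).trans hb
    exact nonneg_of_mul_nonneg_left h (by positivity)
  rw [abs_mul]
  calc |a| * |b| ≤ (K * (1 + |t|)) * (M * (Real.cosh t)⁻¹) :=
        mul_le_mul ha hb (abs_nonneg b) (by positivity)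
    _ = K * M * ((1 + |t|) * (Real.cosh t)⁻¹) := by ring
    _ ≤ K * M * (32 * (1 + t ^ 2)⁻¹) :=
        mul_le_mul_of_nonneg_left (aux_weight t) (by positivity)
    _ = _ := by ring

open Filter in
lemma aux_sq_bot : Tendsto (fun t : ℝ => t ^ 2) atBot atTop := by
  have h := (tendsto_pow_atTop (α := ℝ) two_ne_zero).comp tendsto_neg_atBot_atTop
  refine h.congr fun t => ?_
  simp

open MeasureTheory Filter Topology in
lemma aux_tendsto (C : ℝ) (l : Filter ℝ) (hl : Tendsto (fun t : ℝ => t ^ 2) l atTop)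
    (f : ℝ → ℝ) (hf : ∀ t, |f t| ≤ C * (1 + t ^ 2)⁻¹) : Tendsto f l (𝓝 0) := by
  have h1 : Tendsto (fun t : ℝ => C * (1 + t ^ 2)⁻¹) l (𝓝 (C * 0)) :=
    (tendsto_inv_atTop_zero.comp (tendsto_atTop_add_const_left _ 1 hl)).const_mul C
  rw [mul_zero] at h1
  exact squeeze_zero_norm hf h1

open MeasureTheory in
lemma aux_integrable (C : ℝ) (g : ℝ → ℝ → ℝ) (hg : Continuous (fun p : ℝ × ℝ => g p.1 p.2))
    (hb : ∀ t θ, |θ| ≤ Real.pi → |g t θ| ≤ C * (1 + t ^ 2)⁻¹) :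
    Integrable (fun p : ℝ × ℝ => g p.1 p.2)
      ((volume : Measure ℝ).prod (volume.restrict (Set.Icc (-Real.pi) Real.pi))) := by
  have h1 : Integrable (fun p : ℝ × ℝ => (C * (1 + p.1 ^ 2)⁻¹) * (1 : ℝ))
      ((volume : Measure ℝ).prod (volume.restrict (Set.Icc (-Real.pi) Real.pi))) :=
    Integrable.mul_prod (f := fun t : ℝ => C * (1 + t ^ 2)⁻¹) (g := fun _ : ℝ => (1 : ℝ))
      (integrable_inv_one_add_sq.const_mul C) (integrable_const _)
  refine h1.mono' hg.aestronglyMeasurable ?_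
  have h2 : (volume : Measure ℝ).prod (volume.restrict (Set.Icc (-Real.pi) Real.pi))
      = ((volume : Measure ℝ).prod volume).restrict (Set.univ ×ˢ Set.Icc (-Real.pi) Real.pi) := by
    rw [← Measure.prod_restrict, Measure.restrict_univ]
  rw [h2]
  refine ae_restrict_of_forall_mem (MeasurableSet.univ.prod measurableSet_Icc) ?_
  rintro ⟨t, θ⟩ hp
  have := hb t θ (abs_le.mpr hp.2)
  simpa using this

open MeasureTheory Filter Topology in
lemma aux_key (f f1 f11 f2 f22 : ℝ → ℝ → ℝ) (M : ℝ)
    (cf : Continuous (fun p : ℝ × ℝ => f p.1 p.2))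
    (cf11 : Continuous (fun p : ℝ × ℝ => f11 p.1 p.2))
    (cf22 : Continuous (fun p : ℝ × ℝ => f22 p.1 p.2))
    (d1 : ∀ t θ, HasDerivAt (fun s => f s θ) (f1 t θ) t)
    (d11 : ∀ t θ, HasDerivAt (fun s => f1 s θ) (f11 t θ) t)
    (d2 : ∀ t θ, HasDerivAt (fun s => f t s) (f2 t θ) θ)
    (d22 : ∀ t θ, HasDerivAt (fun s => f2 t s) (f22 t θ) θ)
    (b : ∀ t θ, |θ| ≤ Real.pi → |f t θ| ≤ M * (Real.cosh t)⁻¹)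
    (b1 : ∀ t θ, |θ| ≤ Real.pi → |f1 t θ| ≤ M * (Real.cosh t)⁻¹)
    (b11 : ∀ t θ, |θ| ≤ Real.pi → |f11 t θ| ≤ M * (Real.cosh t)⁻¹)
    (b22 : ∀ t θ, |θ| ≤ Real.pi → |f22 t θ| ≤ M * (Real.cosh t)⁻¹)
    (p0 : ∀ t, f t Real.pi = f t (-Real.pi))
    (p2 : ∀ t, f2 t Real.pi = f2 t (-Real.pi))
    (u u' c c' : ℝ → ℝ) (k : ℝ) (hk0 : 0 ≤ k) (hk1 : k ≤ 1)
    (hu : ∀ t, HasDerivAt u (u' t) t)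
    (hu' : ∀ t, HasDerivAt u' ((k - 2 * ((Real.cosh t)⁻¹) ^ 2) * u t) t)
    (hc : ∀ t, HasDerivAt c (c' t) t)
    (hc' : ∀ t, HasDerivAt c' (-k * c t) t)
    (bu : ∀ t, |u t| ≤ 2 * (1 + |t|)) (bu' : ∀ t, |u' t| ≤ 2 * (1 + |t|))
    (bc : ∀ t, |c t| ≤ 1)
    (pc : c Real.pi = c (-Real.pi)) (pc' : c' Real.pi = c' (-Real.pi)) :
    IntegrableOn (fun p : ℝ × ℝ => u p.1 * c p.2 *
          (f11 p.1 p.2 + f22 p.1 p.2 + 2 * ((Real.cosh p.1)⁻¹) ^ 2 * f p.1 p.2))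
        (Set.univ ×ˢ Set.Icc (-Real.pi) Real.pi) ∧
      ∫ p in Set.univ ×ˢ Set.Icc (-Real.pi) Real.pi, u p.1 * c p.2 *
          (f11 p.1 p.2 + f22 p.1 p.2 + 2 * ((Real.cosh p.1)⁻¹) ^ 2 * f p.1 p.2) = 0 := by
  have hmeas : (volume : Measure (ℝ × ℝ)).restrict (Set.univ ×ˢ Set.Icc (-Real.pi) Real.pi) =
      (volume : Measure ℝ).prod (volume.restrict (Set.Icc (-Real.pi) Real.pi)) := by
    rw [Measure.volume_eq_prod, ← Measure.prod_restrict, Measure.restrict_univ]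
  have hpi := Real.pi_pos
  have cu : Continuous u := continuous_iff_continuousAt.2 fun t => (hu t).continuousAt
  have cc : Continuous c := continuous_iff_continuousAt.2 fun t => (hc t).continuousAt
  have csech : Continuous (fun t : ℝ => (Real.cosh t)⁻¹) :=
    Real.continuous_cosh.inv₀ fun t => (Real.cosh_pos t).ne'
  have cu1 : Continuous (fun p : ℝ × ℝ => u p.1) := cu.comp continuous_fst
  have cc2 : Continuous (fun p : ℝ × ℝ => c p.2) := cc.comp continuous_snd
  have cs1 : Continuous (fun p : ℝ × ℝ => (Real.cosh p.1)⁻¹) := csech.comp continuous_fst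
  have bq : ∀ t : ℝ, |k - 2 * ((Real.cosh t)⁻¹) ^ 2| ≤ 2 := by
    intro t
    have h1 : (Real.cosh t)⁻¹ ≤ 1 := inv_le_one_of_one_le₀ (Real.one_le_cosh t)
    have h0 : 0 ≤ (Real.cosh t)⁻¹ := inv_nonneg.2 (Real.cosh_pos t).le
    rw [abs_le]; constructor <;> nlinarith
  have bquc : ∀ t θ : ℝ, |(k - 2 * ((Real.cosh t)⁻¹) ^ 2) * u t * c θ| ≤ 4 * (1 + |t|) := by
    intro t θ
    have h0 : 0 ≤ |t| := abs_nonneg t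
    rw [abs_mul, abs_mul]
    calc _ ≤ 2 * (2 * (1 + |t|)) * 1 := by
          gcongr
          · exact bq t
          · exact bu t
          · exact bc θ
      _ = _ := by ring
  have buc : ∀ t θ : ℝ, |u t * c θ| ≤ 2 * (1 + |t|) := by
    intro t θ
    rw [abs_mul]
    calc _ ≤ (2 * (1 + |t|)) * 1 := by
          gcongr
          · exact bu t
          · exact bc θ
      _ = _ := by ring
  have bkuc : ∀ t θ : ℝ, |-k * (u t * c θ)| ≤ 2 * (1 + |t|) := by
    intro t θ
    rw [abs_mul, abs_neg, abs_of_nonneg hk0]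
    nlinarith [buc t θ, abs_nonneg (u t * c θ)]
  -- the two pieces
  set A : ℝ → ℝ → ℝ := fun t θ =>
    u t * c θ * f11 t θ - (k - 2 * ((Real.cosh t)⁻¹) ^ 2) * u t * c θ * f t θ with hA
  set B : ℝ → ℝ → ℝ := fun t θ =>
    u t * c θ * f22 t θ - -k * (u t * c θ) * f t θ with hB
  have cA : Continuous (fun p : ℝ × ℝ => A p.1 p.2) := by
    simp only [hA]; fun_prop
  have cB : Continuous (fun p : ℝ × ℝ => B p.1 p.2) := by
    simp only [hB]; fun_prop
  have bA : ∀ t θ, |θ| ≤ Real.pi →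
      |A t θ| ≤ (2 * M * 32 + 4 * M * 32) * (1 + t ^ 2)⁻¹ := by
    intro t θ hθ
    have h1 := aux_mul (buc t θ) (by norm_num) (b11 t θ hθ)
    have h2 := aux_mul (bquc t θ) (by norm_num) (b t θ hθ)
    simp only [hA]
    refine (abs_sub _ _).trans ?_
    linarith
  have bB : ∀ t θ, |θ| ≤ Real.pi →
      |B t θ| ≤ (2 * M * 32 + 2 * M * 32) * (1 + t ^ 2)⁻¹ := by
    intro t θ hθ
    have h1 := aux_mul (buc t θ) (by norm_num) (b22 t θ hθ)
    have h2 := aux_mul (bkuc t θ) (by norm_num) (b t θ hθ)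
    simp only [hB]
    refine (abs_sub _ _).trans ?_
    linarith
  have iA := aux_integrable _ A cA bA
  have iB := aux_integrable _ B cB bB
  have hsum : (fun p : ℝ × ℝ => u p.1 * c p.2 *
          (f11 p.1 p.2 + f22 p.1 p.2 + 2 * ((Real.cosh p.1)⁻¹) ^ 2 * f p.1 p.2))
      = fun p : ℝ × ℝ => A p.1 p.2 + B p.1 p.2 := by
    funext p; simp only [hA, hB]; ring
  have zA : ∀ θ, |θ| ≤ Real.pi → ∫ t, A t θ = 0 := by
    intro θ hθ
    have hd : ∀ t, HasDerivAt
        (fun s => u s * c θ * f1 s θ - (u' s * c θ) * f s θ) (A t θ) t := by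
      intro t
      have := (((hu t).mul_const (c θ)).mul (d11 t θ)).sub
        (((hu' t).mul_const (c θ)).mul (d1 t θ))
      refine HasDerivAt.congr_deriv this ?_
      simp only [hA]; ring
    have hb : ∀ t, |u t * c θ * f1 t θ - (u' t * c θ) * f t θ|
        ≤ (2 * M * 32 + 2 * M * 32) * (1 + t ^ 2)⁻¹ := by
      intro t
      have hu'c : |u' t * c θ| ≤ 2 * (1 + |t|) := by
        rw [abs_mul]
        calc _ ≤ (2 * (1 + |t|)) * 1 := by
              gcongr
              · exact bu' t
              · exact bc θ
          _ = _ := by ring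
      have h1 := aux_mul (buc t θ) (by norm_num) (b1 t θ hθ)
      have h2 := aux_mul hu'c (by norm_num) (b t θ hθ)
      refine (abs_sub _ _).trans ?_
      linarith
    have hi : Integrable (fun t => A t θ) := by
      refine (integrable_inv_one_add_sq.const_mul (2 * M * 32 + 4 * M * 32)).mono'
        (cA.comp (continuous_id.prodMk continuous_const)).aestronglyMeasurable ?_
      exact Eventually.of_forall fun t => bA t θ hθ
    have := integral_of_hasDerivAt_of_tendsto hd hi
      (aux_tendsto _ _ aux_sq_bot _ hb)
      (aux_tendsto _ _ (tendsto_pow_atTop two_ne_zero) _ hb)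
    rw [this, sub_zero]
  have zB : ∀ t, ∫ θ in Set.Icc (-Real.pi) Real.pi, B t θ = 0 := by
    intro t
    have hd : ∀ θ, HasDerivAt
        (fun s => u t * (c s * f2 t s - c' s * f t s)) (B t θ) θ := by
      intro θ
      have := (((hc θ).mul (d22 t θ)).sub ((hc' θ).mul (d2 t θ))).const_mul (u t)
      refine HasDerivAt.congr_deriv this ?_
      simp only [hB]; ring
    rw [integral_Icc_eq_integral_Ioc, ← intervalIntegral.integral_of_le (by linarith),
      intervalIntegral.integral_eq_sub_of_hasDerivAt (fun θ _ => hd θ)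
        ((cB.comp (continuous_const.prodMk continuous_id)).intervalIntegrable _ _)]
    rw [p0, p2, pc, pc', sub_self]
  constructor
  · rw [IntegrableOn, hmeas, hsum]
    exact iA.add iB
  · rw [hmeas, hsum, integral_add iA iB, integral_prod_symm _ iA, integral_prod _ iB]
    simp only [zB, integral_zero, add_zero]
    rw [setIntegral_congr_fun measurableSet_Icc (g := fun _ => (0 : ℝ))]
    · simp
    · intro θ hθ
      exact zA θ (abs_le.2 hθ)

lemma aux_tanh (t : ℝ) : HasDerivAt Real.tanh (((Real.cosh t)⁻¹) ^ 2) t := by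
  have h := (Real.hasDerivAt_sinh t).div (Real.hasDerivAt_cosh t) (Real.cosh_pos t).ne'
  have e : Real.tanh = fun s => Real.sinh s / Real.cosh s := by
    funext s; exact Real.tanh_eq_sinh_div_cosh s
  rw [e]
  refine HasDerivAt.congr_deriv h ?_
  have := Real.cosh_sq t
  have h0 := (Real.cosh_pos t).ne'
  field_simp
  linarith

lemma aux_sech (t : ℝ) :
    HasDerivAt (fun s => (Real.cosh s)⁻¹) (-(Real.tanh t * (Real.cosh t)⁻¹)) t := by
  have h := (Real.hasDerivAt_cosh t).inv (Real.cosh_pos t).ne'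
  refine HasDerivAt.congr_deriv h ?_
  have h0 := (Real.cosh_pos t).ne'
  rw [Real.tanh_eq_sinh_div_cosh]
  field_simp

lemma aux_tanh_sq (t : ℝ) : Real.tanh t ^ 2 = 1 - ((Real.cosh t)⁻¹) ^ 2 := by
  have := Real.cosh_sq t
  have h0 := (Real.cosh_pos t).ne'
  rw [Real.tanh_eq_sinh_div_cosh]
  field_simp
  linarith

open MeasureTheory Filter Topology in
lemma aux_main (φ : ℝ → ℝ → ℝ)
    (hφ : ContDiff ℝ 2 (fun p : ℝ × ℝ => φ p.1 p.2))
    (hper : ∀ t θ : ℝ, φ t (θ + 2 * Real.pi) = φ t θ)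
    (hdecay : ∃ M : ℝ, ∀ t θ : ℝ, |θ| ≤ Real.pi → Real.cosh t * C2w φ t θ ≤ M)
    (u u' c c' : ℝ → ℝ) (k : ℝ) (hk0 : 0 ≤ k) (hk1 : k ≤ 1)
    (hu : ∀ t, HasDerivAt u (u' t) t)
    (hu' : ∀ t, HasDerivAt u' ((k - 2 * ((Real.cosh t)⁻¹) ^ 2) * u t) t)
    (hc : ∀ t, HasDerivAt c (c' t) t)
    (hc' : ∀ t, HasDerivAt c' (-k * c t) t)
    (bu : ∀ t, |u t| ≤ 2 * (1 + |t|)) (bu' : ∀ t, |u' t| ≤ 2 * (1 + |t|))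
    (bc : ∀ t, |c t| ≤ 1)
    (pc : c Real.pi = c (-Real.pi)) (pc' : c' Real.pi = c' (-Real.pi)) :
    IntegrableOn (fun p : ℝ × ℝ => u p.1 * c p.2 *
          (pt (pt φ) p.1 p.2 + pθ (pθ φ) p.1 p.2 + 2 * ((Real.cosh p.1)⁻¹) ^ 2 * φ p.1 p.2))
        (Set.univ ×ˢ Set.Icc (-Real.pi) Real.pi) ∧
      ∫ p in Set.univ ×ˢ Set.Icc (-Real.pi) Real.pi, u p.1 * c p.2 *
          (pt (pt φ) p.1 p.2 + pθ (pθ φ) p.1 p.2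
            + 2 * ((Real.cosh p.1)⁻¹) ^ 2 * φ p.1 p.2) = 0 := by
  obtain ⟨M, hM⟩ := hdecay
  set F : ℝ × ℝ → ℝ := fun p => φ p.1 p.2 with hF
  have dF : Differentiable ℝ F := hφ.differentiable (by norm_num)
  have hφ1 : ContDiff ℝ 1 (fderiv ℝ F) := hφ.fderiv_right (by norm_num)
  have dF1 : Differentiable ℝ (fderiv ℝ F) := hφ1.differentiable (by norm_num)
  have cF2 : Continuous (fderiv ℝ (fderiv ℝ F)) := hφ1.continuous_fderiv (by norm_num)
  have l1 : ∀ t θ : ℝ, HasDerivAt (fun s : ℝ => (s, θ)) ((1 : ℝ), (0 : ℝ)) t := fun t θ =>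
    (hasDerivAt_id t).prodMk (hasDerivAt_const t θ)
  have l2 : ∀ t θ : ℝ, HasDerivAt (fun s : ℝ => (t, s)) ((0 : ℝ), (1 : ℝ)) θ := fun t θ =>
    (hasDerivAt_const θ t).prodMk (hasDerivAt_id θ)
  have d1 : ∀ t θ, HasDerivAt (fun s => φ s θ) (fderiv ℝ F (t, θ) (1, 0)) t := fun t θ =>
    HasFDerivAt.comp_hasDerivAt (l := F) t (dF (t, θ)).hasFDerivAt (l1 t θ)
  have d2 : ∀ t θ, HasDerivAt (fun s => φ t s) (fderiv ℝ F (t, θ) (0, 1)) θ := fun t θ =>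
    HasFDerivAt.comp_hasDerivAt (l := F) θ (dF (t, θ)).hasFDerivAt (l2 t θ)
  have e1 : pt φ = fun t θ => fderiv ℝ F (t, θ) (1, 0) := by
    funext t θ; exact (d1 t θ).deriv
  have e2 : pθ φ = fun t θ => fderiv ℝ F (t, θ) (0, 1) := by
    funext t θ; exact (d2 t θ).deriv
  have d11 : ∀ t θ, HasDerivAt (fun s => fderiv ℝ F (s, θ) (1, 0))
      (fderiv ℝ (fderiv ℝ F) (t, θ) (1, 0) (1, 0)) t := fun t θ => by
    have h := (dF1 (t, θ)).hasFDerivAt.comp_hasDerivAt t (l1 t θ)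
    simpa using h.clm_apply (hasDerivAt_const t ((1 : ℝ), (0 : ℝ)))
  have d22 : ∀ t θ, HasDerivAt (fun s => fderiv ℝ F (t, s) (0, 1))
      (fderiv ℝ (fderiv ℝ F) (t, θ) (0, 1) (0, 1)) θ := fun t θ => by
    have h := (dF1 (t, θ)).hasFDerivAt.comp_hasDerivAt θ (l2 t θ)
    simpa using h.clm_apply (hasDerivAt_const θ ((0 : ℝ), (1 : ℝ)))
  have e11 : pt (pt φ) = fun t θ => fderiv ℝ (fderiv ℝ F) (t, θ) (1, 0) (1, 0) := by
    rw [e1]; funext t θ; exact (d11 t θ).deriv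
  have e22 : pθ (pθ φ) = fun t θ => fderiv ℝ (fderiv ℝ F) (t, θ) (0, 1) (0, 1) := by
    rw [e2]; funext t θ; exact (d22 t θ).deriv
  have n1 : ‖((1 : ℝ), (0 : ℝ))‖ ≤ 1 := by simp [Prod.norm_def]
  have n2 : ‖((0 : ℝ), (1 : ℝ))‖ ≤ 1 := by simp [Prod.norm_def]
  have hW : ∀ t θ : ℝ, |θ| ≤ Real.pi → C2w φ t θ ≤ M * (Real.cosh t)⁻¹ := by
    intro t θ hθ
    rw [← div_eq_mul_inv, le_div_iff₀ (Real.cosh_pos t), mul_comm]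
    exact hM t θ hθ
  have m0 : ∀ t θ, |φ t θ| ≤ C2w φ t θ := by
    intro t θ; unfold C2w
    linarith [norm_nonneg (fderiv ℝ F (t, θ)), norm_nonneg (fderiv ℝ (fderiv ℝ F) (t, θ))]
  have m1 : ∀ t θ, ‖fderiv ℝ F (t, θ)‖ ≤ C2w φ t θ := by
    intro t θ; unfold C2w
    linarith [abs_nonneg (φ t θ), norm_nonneg (fderiv ℝ (fderiv ℝ F) (t, θ))]
  have m2 : ∀ t θ, ‖fderiv ℝ (fderiv ℝ F) (t, θ)‖ ≤ C2w φ t θ := by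
    intro t θ; unfold C2w
    linarith [abs_nonneg (φ t θ), norm_nonneg (fderiv ℝ F (t, θ))]
  have q2 : ∀ t θ (v : ℝ × ℝ), ‖v‖ ≤ 1 →
      |fderiv ℝ (fderiv ℝ F) (t, θ) v v| ≤ C2w φ t θ := by
    intro t θ v hv
    have h := (fderiv ℝ (fderiv ℝ F) (t, θ)).le_opNorm₂ v v
    rw [Real.norm_eq_abs] at h
    refine h.trans (le_trans ?_ (m2 t θ))
    calc _ ≤ ‖fderiv ℝ (fderiv ℝ F) (t, θ)‖ * 1 * 1 := by gcongr
      _ = _ := by ring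
  rw [e11, e22]
  have hpp : ∀ t, φ t Real.pi = φ t (-Real.pi) := by
    intro t
    rw [← hper t (-Real.pi)]; congr 1; ring
  refine aux_key φ (fun t θ => fderiv ℝ F (t, θ) (1, 0)) _ (fun t θ => fderiv ℝ F (t, θ) (0, 1))
    _ M hφ.continuous ?_ ?_ d1 d11 d2 d22
    (fun t θ h => (m0 t θ).trans (hW t θ h)) ?_
    (fun t θ h => (q2 t θ _ n1).trans (hW t θ h)) (fun t θ h => (q2 t θ _ n2).trans (hW t θ h))
    hpp ?_ u u' c c' k hk0 hk1 hu hu' hc hc' bu bu' bc pc pc'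
  · exact (cF2.clm_apply continuous_const).clm_apply continuous_const
  · exact (cF2.clm_apply continuous_const).clm_apply continuous_const
  · intro t θ h
    have h1 := (fderiv ℝ F (t, θ)).le_opNorm ((1 : ℝ), (0 : ℝ))
    rw [Real.norm_eq_abs] at h1
    refine h1.trans (le_trans ?_ ((m1 t θ).trans (hW t θ h)))
    calc _ ≤ ‖fderiv ℝ F (t, θ)‖ * 1 := by gcongr
      _ = _ := by ring
  · intro t
    show fderiv ℝ F (t, Real.pi) (0, 1) = fderiv ℝ F (t, -Real.pi) (0, 1)
    rw [← (d2 t Real.pi).deriv, ← (d2 t (-Real.pi)).deriv]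
    have h := deriv_comp_add_const (f := fun s => φ t s) (a := 2 * Real.pi) (x := -Real.pi)
    simp only [hper] at h
    rw [h]; congr 1; ring

/-- Orthogonality relations for the limiting Jacobi operator
𝓛₀φ = Δφ + 2(sech t)²φ: each element of 𝒲₀ integrates 𝓛₀φ to zero. -/
theorem orthogonality_limiting_jacobi_operator
    (φ : ℝ → ℝ → ℝ)
    (hφ : ContDiff ℝ 2 (fun p : ℝ × ℝ => φ p.1 p.2))
    (hper : ∀ t θ : ℝ, φ t (θ + 2 * Real.pi) = φ t θ)
    (hdecay : ∃ M : ℝ, ∀ t θ : ℝ, |θ| ≤ Real.pi → Real.cosh t * C2w φ t θ ≤ M) :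
    ∀ w : ℝ → ℝ → ℝ,
      (w = fun t _ => -1 + t * Real.tanh t) ∨
      (w = fun t _ => -Real.tanh t) ∨
      (w = fun t θ => (Real.cosh t)⁻¹ * Real.cos θ) ∨
      (w = fun t θ => (Real.cosh t)⁻¹ * Real.sin θ) →
      MeasureTheory.IntegrableOn
        (fun p : ℝ × ℝ => w p.1 p.2 *
          (pt (pt φ) p.1 p.2 + pθ (pθ φ) p.1 p.2
            + 2 * ((Real.cosh p.1)⁻¹) ^ 2 * φ p.1 p.2))
        (Set.univ ×ˢ Set.Icc (-Real.pi) Real.pi) ∧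
      ∫ p in Set.univ ×ˢ Set.Icc (-Real.pi) Real.pi,
        w p.1 p.2 * (pt (pt φ) p.1 p.2 + pθ (pθ φ) p.1 p.2
          + 2 * ((Real.cosh p.1)⁻¹) ^ 2 * φ p.1 p.2) = 0 := by
  intro w hw
  have hs0 : ∀ t : ℝ, 0 ≤ (Real.cosh t)⁻¹ := fun t => inv_nonneg.2 (Real.cosh_pos t).le
  have hs1 : ∀ t : ℝ, (Real.cosh t)⁻¹ ≤ 1 := fun t =>
    inv_le_one_of_one_le₀ (Real.one_le_cosh t)
  have hT : ∀ t : ℝ, |Real.tanh t| ≤ 1 := fun t => (Real.abs_tanh_lt_one t).le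
  have hs2 : ∀ t : ℝ, |((Real.cosh t)⁻¹) ^ 2| ≤ 1 := fun t => by
    rw [abs_of_nonneg (by positivity)]; exact pow_le_one₀ (hs0 t) (hs1 t)
  have hts : ∀ t : ℝ, |Real.tanh t * (Real.cosh t)⁻¹| ≤ 1 := fun t => by
    rw [abs_mul, abs_of_nonneg (hs0 t)]
    exact mul_le_one₀ (hT t) (hs0 t) (hs1 t)
  have hsech2 : ∀ t : ℝ, HasDerivAt (fun s => ((Real.cosh s)⁻¹) ^ 2)
      (-(2 * Real.tanh t * ((Real.cosh t)⁻¹) ^ 2)) t := fun t => by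
    have := (aux_sech t).pow 2
    refine HasDerivAt.congr_deriv this ?_
    push_cast
    ring
  have hsu' : ∀ t : ℝ, HasDerivAt (fun s => -(Real.tanh s * (Real.cosh s)⁻¹))
      ((1 - 2 * ((Real.cosh t)⁻¹) ^ 2) * (Real.cosh t)⁻¹) t := fun t => by
    have := ((aux_tanh t).mul (aux_sech t)).neg
    refine HasDerivAt.congr_deriv this ?_
    have h := aux_tanh_sq t
    linear_combination (Real.cosh t)⁻¹ * h
  have hsb : ∀ t : ℝ, |(Real.cosh t)⁻¹| ≤ 2 * (1 + |t|) := fun t => by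
    rw [abs_of_nonneg (hs0 t)]; linarith [hs1 t, abs_nonneg t]
  have hsb' : ∀ t : ℝ, |-(Real.tanh t * (Real.cosh t)⁻¹)| ≤ 2 * (1 + |t|) := fun t => by
    rw [abs_neg]; linarith [hts t, abs_nonneg t]
  rcases hw with rfl | rfl | rfl | rfl
  · have h := aux_main φ hφ hper hdecay (fun t => -1 + t * Real.tanh t)
      (fun t => Real.tanh t + t * ((Real.cosh t)⁻¹) ^ 2) (fun _ => 1) (fun _ => 0) 0 le_rfl
      zero_le_one
      (fun t => by
        have := ((hasDerivAt_id t).mul (aux_tanh t)).const_add (-1)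
        refine HasDerivAt.congr_deriv this ?_
        simp)
      (fun t => by
        have := (aux_tanh t).add ((hasDerivAt_id t).mul (hsech2 t))
        refine HasDerivAt.congr_deriv this ?_
        simp only [id]
        ring)
      (fun t => hasDerivAt_const _ _) (fun t => by simpa using hasDerivAt_const t (0 : ℝ))
      (fun t => by
        have h1 : |t * Real.tanh t| ≤ |t| := by
          rw [abs_mul]; exact mul_le_of_le_one_right (abs_nonneg t) (hT t)
        have h2 := abs_add_le (-1 : ℝ) (t * Real.tanh t)
        rw [abs_neg, abs_one] at h2
        linarith [abs_nonneg t])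
      (fun t => by
        have h1 : |t * ((Real.cosh t)⁻¹) ^ 2| ≤ |t| := by
          rw [abs_mul]; exact mul_le_of_le_one_right (abs_nonneg t) (hs2 t)
        have h2 := abs_add_le (Real.tanh t) (t * ((Real.cosh t)⁻¹) ^ 2)
        linarith [abs_nonneg t, hT t])
      (fun _ => by simp) rfl rfl
    simpa only [mul_one] using h
  · have h := aux_main φ hφ hper hdecay (fun t => -Real.tanh t)
      (fun t => -((Real.cosh t)⁻¹) ^ 2) (fun _ => 1) (fun _ => 0) 0 le_rfl
      zero_le_one
      (fun t => (aux_tanh t).neg)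
      (fun t => by
        have := (hsech2 t).neg
        refine HasDerivAt.congr_deriv this ?_
        ring)
      (fun t => hasDerivAt_const _ _) (fun t => by simpa using hasDerivAt_const t (0 : ℝ))
      (fun t => by rw [abs_neg]; linarith [abs_nonneg t, hT t])
      (fun t => by rw [abs_neg]; linarith [abs_nonneg t, hs2 t])
      (fun _ => by simp) rfl rfl
    simpa only [mul_one] using h
  · exact aux_main φ hφ hper hdecay (fun t => (Real.cosh t)⁻¹)
      (fun t => -(Real.tanh t * (Real.cosh t)⁻¹)) Real.cos (fun t => -Real.sin t) 1 zero_le_one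
      le_rfl aux_sech hsu' Real.hasDerivAt_cos
      (fun t => HasDerivAt.congr_deriv (Real.hasDerivAt_sin t).neg (by simp)) hsb hsb'
      Real.abs_cos_le_one (by simp) (by simp)
  · exact aux_main φ hφ hper hdecay (fun t => (Real.cosh t)⁻¹)
      (fun t => -(Real.tanh t * (Real.cosh t)⁻¹)) Real.sin Real.cos 1 zero_le_one
      le_rfl aux_sech hsu' Real.hasDerivAt_sin
      (fun t => by simpa using Real.hasDerivAt_cos t) hsb hsb'
      Real.abs_sin_le_one (by simp) (by simp)


end Delaunay
end
end

section
/- First variation of the mean curvature under normal perturbations of an orthogonal parametrization. Let Ω ⊂ ℝ² be a domain and X : Ω → ℝ³ a smooth regular parametrization with X_t · X_θ = 0 and X_t ∧ X_θ ≠ 0 on Ω, with unit normal N = (X_t ∧ X_θ)/|X_t ∧ X_θ|. Then for every φ ∈ C²(Ω) and every (t,θ) ∈ Ω, the derivative at s = 0 of s ↦ 𝔐(X + sφN)(t,θ) exists and equals: (1/(2|X_t|²))φ_tt + (1/(2|X_θ|²))φ_θθ + [ (∂_t(|X_θ|²))/(4|X_t|²|X_θ|²) − (∂_t(|X_t|²))/(4|X_t|⁴)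 ]φ_t + [ (∂_θ(|X_t|²))/(4|X_t|²|X_θ|²) − (∂_θ(|X_θ|²))/(4|X_θ|⁴) ]φ_θ + [ 2(X_tθ·N)²/(|X_t|²|X_θ|²) − |N_θ|²/(2|X_θ|²) − |N_t|²/(2|X_t|²) + (X_tt·N)²/|X_t|⁴ + (X_θθ·N)²/|X_θ|⁴ ]φ. -/
noncomputable section

namespace Delaunay

section Aux

lemma dot3_hasDerivAt {f g : ℝ → V3} {f' g' : V3} {x : ℝ} (hf : HasDerivAt f f' x)
    (hg : HasDerivAt g g' x) :
    HasDerivAt (fun s => dot3 (f s) (g s)) (dot3 f' (g x) + dot3 (f x) g') x := by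
  have F := hasDerivAt_pi.1 hf
  have G := hasDerivAt_pi.1 hg
  have := (((F 0).mul (G 0)).add ((F 1).mul (G 1))).add ((F 2).mul (G 2))
  refine this.congr_deriv ?_
  simp only [dot3]; ring

lemma dot3_contDiffOn {n : WithTop ℕ∞} {Ω : Set (ℝ × ℝ)} {f g : ℝ × ℝ → V3}
    (hf : ContDiffOn ℝ n f Ω) (hg : ContDiffOn ℝ n g Ω) :
    ContDiffOn ℝ n (fun p => dot3 (f p) (g p)) Ω := by
  have F := contDiffOn_pi.1 hf
  have G := contDiffOn_pi.1 hg
  exact (((F 0).mul (G 0)).add ((F 1).mul (G 1))).add ((F 2).mul (G 2))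

lemma cross3_contDiffOn {n : WithTop ℕ∞} {Ω : Set (ℝ × ℝ)} {f g : ℝ × ℝ → V3}
    (hf : ContDiffOn ℝ n f Ω) (hg : ContDiffOn ℝ n g Ω) :
    ContDiffOn ℝ n (fun p => cross3 (f p) (g p)) Ω := by
  have F := contDiffOn_pi.1 hf
  have G := contDiffOn_pi.1 hg
  refine contDiffOn_pi.2 fun i => ?_
  fin_cases i
  · exact ((F 1).mul (G 2)).sub ((F 2).mul (G 1))
  · exact ((F 2).mul (G 0)).sub ((F 0).mul (G 2))
  · exact ((F 0).mul (G 1)).sub ((F 1).mul (G 0))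

lemma cross3_differentiableAt {f g : ℝ → V3} {x : ℝ}
    (hf : DifferentiableAt ℝ f x) (hg : DifferentiableAt ℝ g x) :
    DifferentiableAt ℝ (fun p => cross3 (f p) (g p)) x := by
  have F := differentiableAt_pi.1 hf
  have G := differentiableAt_pi.1 hg
  refine differentiableAt_pi.2 fun i => ?_
  fin_cases i
  · exact ((F 1).mul (G 2)).sub ((F 2).mul (G 1))
  · exact ((F 2).mul (G 0)).sub ((F 0).mul (G 2))
  · exact ((F 0).mul (G 1)).sub ((F 1).mul (G 0))

lemma dot3_self_pos {v : V3} (hv : v ≠ 0) : 0 < dot3 v v := by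
  have h : ∃ i, v i ≠ 0 := by
    by_contra! h
    exact hv (funext h)
  obtain ⟨i, hi⟩ := h
  have := mul_self_pos.2 hi
  simp only [dot3]
  fin_cases i <;> simp only [Fin.zero_eta, Fin.mk_one, Fin.reduceFinMk] at this <;>
    nlinarith [mul_self_nonneg (v 0), mul_self_nonneg (v 1), mul_self_nonneg (v 2)]

lemma norm3_pos {v : V3} (hv : v ≠ 0) : 0 < norm3 v := Real.sqrt_pos.2 (dot3_self_pos hv)

lemma norm3_sq (v : V3) : norm3 v ^ 2 = dot3 v v := by
  refine Real.sq_sqrt ?_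
  simp only [dot3]
  nlinarith [mul_self_nonneg (v 0), mul_self_nonneg (v 1), mul_self_nonneg (v 2)]

lemma unit_self {v : V3} (hv : v ≠ 0) : dot3 ((norm3 v)⁻¹ • v) ((norm3 v)⁻¹ • v) = 1 := by
  have h1 := norm3_sq v
  have h2 := (norm3_pos hv).ne'
  have : dot3 ((norm3 v)⁻¹ • v) ((norm3 v)⁻¹ • v) = (norm3 v)⁻¹ ^ 2 * dot3 v v := by
    simp only [dot3, Pi.smul_apply, smul_eq_mul]; ring
  rw [this, ← h1]; field_simp

lemma unit_contDiffOn {n : WithTop ℕ∞} {Ω : Set (ℝ × ℝ)} {f : ℝ × ℝ → V3}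
    (hf : ContDiffOn ℝ n f Ω) (h0 : ∀ p ∈ Ω, f p ≠ 0) :
    ContDiffOn ℝ n (fun p => (norm3 (f p))⁻¹ • f p) Ω :=
  (((dot3_contDiffOn hf hf).sqrt fun p hp => (dot3_self_pos (h0 p hp)).ne').inv
    fun p hp => (norm3_pos (h0 p hp)).ne').smul hf

lemma unit_differentiableAt {f : ℝ → V3} {x : ℝ} (hf : DifferentiableAt ℝ f x) (h0 : f x ≠ 0) :
    DifferentiableAt ℝ (fun p => (norm3 (f p))⁻¹ • f p) x :=
  (((dot3_hasDerivAt hf.hasDerivAt hf.hasDerivAt).differentiableAt.sqrt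
    (dot3_self_pos h0).ne').inv (norm3_pos h0).ne').smul hf

section Partials

variable {E : Type*} [NormedAddCommGroup E] [NormedSpace ℝ E] {Ω : Set (ℝ × ℝ)}
  {f g : ℝ → ℝ → E} {t θ : ℝ}

lemma hasDerivAt_pt_fderiv (h : DifferentiableAt ℝ (fun p : ℝ × ℝ => f p.1 p.2) (t, θ)) :
    HasDerivAt (fun u => f u θ) (fderiv ℝ (fun p : ℝ × ℝ => f p.1 p.2) (t, θ) (1, 0)) t :=
  HasFDerivAt.comp_hasDerivAt (f := fun u : ℝ => (u, θ)) t h.hasFDerivAt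
    ((hasDerivAt_id t).prodMk (hasDerivAt_const t θ))

lemma hasDerivAt_pθ_fderiv (h : DifferentiableAt ℝ (fun p : ℝ × ℝ => f p.1 p.2) (t, θ)) :
    HasDerivAt (fun u => f t u) (fderiv ℝ (fun p : ℝ × ℝ => f p.1 p.2) (t, θ) (0, 1)) θ :=
  HasFDerivAt.comp_hasDerivAt (f := fun u : ℝ => (t, u)) θ h.hasFDerivAt
    ((hasDerivAt_const θ t).prodMk (hasDerivAt_id θ))

lemma diffAt_of (hΩ : IsOpen Ω) {n : WithTop ℕ∞} (hn : 1 ≤ n) {F : ℝ × ℝ → E}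
    (h : ContDiffOn ℝ n F Ω) {p : ℝ × ℝ} (hp : p ∈ Ω) : DifferentiableAt ℝ F p :=
  (h.differentiableOn (by
    intro h0; subst h0; exact absurd hn (by decide))).differentiableAt (hΩ.mem_nhds hp)

lemma hasDerivAt_pt (hΩ : IsOpen Ω) (h : ContDiffOn ℝ 1 (fun p : ℝ × ℝ => f p.1 p.2) Ω)
    (hp : (t, θ) ∈ Ω) : HasDerivAt (fun u => f u θ) (pt f t θ) t :=
  (hasDerivAt_pt_fderiv (diffAt_of hΩ le_rfl h hp)).differentiableAt.hasDerivAt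

lemma hasDerivAt_pθ (hΩ : IsOpen Ω) (h : ContDiffOn ℝ 1 (fun p : ℝ × ℝ => f p.1 p.2) Ω)
    (hp : (t, θ) ∈ Ω) : HasDerivAt (fun u => f t u) (pθ f t θ) θ :=
  (hasDerivAt_pθ_fderiv (diffAt_of hΩ le_rfl h hp)).differentiableAt.hasDerivAt

lemma contDiffOn_pt (hΩ : IsOpen Ω) {m n : WithTop ℕ∞} (hmn : m + 1 ≤ n)
    (h : ContDiffOn ℝ n (fun p : ℝ × ℝ => f p.1 p.2) Ω) :
    ContDiffOn ℝ m (fun p : ℝ × ℝ => pt f p.1 p.2) Ω := by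
  have h1 := (h.fderiv_of_isOpen hΩ hmn).clm_apply (contDiffOn_const (c := ((1 : ℝ), (0 : ℝ))))
  refine h1.congr fun p hp => ?_
  exact (hasDerivAt_pt_fderiv (f := f) (diffAt_of hΩ (le_trans le_add_self hmn) h hp)).deriv

lemma contDiffOn_pθ (hΩ : IsOpen Ω) {m n : WithTop ℕ∞} (hmn : m + 1 ≤ n)
    (h : ContDiffOn ℝ n (fun p : ℝ × ℝ => f p.1 p.2) Ω) :
    ContDiffOn ℝ m (fun p : ℝ × ℝ => pθ f p.1 p.2) Ω := by
  have h1 := (h.fderiv_of_isOpen hΩ hmn).clm_apply (contDiffOn_const (c := ((0 : ℝ), (1 : ℝ))))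
  refine h1.congr fun p hp => ?_
  exact (hasDerivAt_pθ_fderiv (f := f) (diffAt_of hΩ (le_trans le_add_self hmn) h hp)).deriv

lemma pt_congr (hΩ : IsOpen Ω) (h : ∀ p ∈ Ω, f p.1 p.2 = g p.1 p.2) (hp : (t, θ) ∈ Ω) :
    pt f t θ = pt g t θ := by
  refine Filter.EventuallyEq.deriv_eq ?_
  have : ContinuousAt (fun u : ℝ => (u, θ)) t := by fun_prop
  filter_upwards [this.preimage_mem_nhds (hΩ.mem_nhds hp)] with u hu using h _ hu

lemma pθ_congr (hΩ : IsOpen Ω) (h : ∀ p ∈ Ω, f p.1 p.2 = g p.1 p.2) (hp : (t, θ) ∈ Ω) :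
    pθ f t θ = pθ g t θ := by
  refine Filter.EventuallyEq.deriv_eq ?_
  have : ContinuousAt (fun u : ℝ => (t, u)) θ := by fun_prop
  filter_upwards [this.preimage_mem_nhds (hΩ.mem_nhds hp)] with u hu using h _ hu

lemma pt_pθ_comm (hΩ : IsOpen Ω) (h : ContDiffOn ℝ 2 (fun p : ℝ × ℝ => f p.1 p.2) Ω)
    (hp : (t, θ) ∈ Ω) : pt (pθ f) t θ = pθ (pt f) t θ := by
  have hd : DifferentiableAt ℝ (fderiv ℝ (fun p : ℝ × ℝ => f p.1 p.2)) (t, θ) :=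
    diffAt_of (n := 1) hΩ le_rfl (h.fderiv_of_isOpen hΩ (by norm_num)) hp
  have hs : IsSymmSndFDerivAt ℝ (fun p : ℝ × ℝ => f p.1 p.2) (t, θ) :=
    (h.contDiffAt (hΩ.mem_nhds hp)).isSymmSndFDerivAt (by simp)
  set F := fun p : ℝ × ℝ => f p.1 p.2 with hF
  have e1 : pt (pθ f) t θ = pt (fun u v => fderiv ℝ F (u, v) (0, 1)) t θ :=
    pt_congr hΩ (fun p hp => (hasDerivAt_pθ_fderiv (f := f)
      (diffAt_of hΩ (by norm_num) h hp)).deriv) hp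
  have e2 : pθ (pt f) t θ = pθ (fun u v => fderiv ℝ F (u, v) (1, 0)) t θ :=
    pθ_congr hΩ (fun p hp => (hasDerivAt_pt_fderiv (f := f)
      (diffAt_of hΩ (by norm_num) h hp)).deriv) hp
  have d1 := (hasDerivAt_pt_fderiv (f := fun u v => fderiv ℝ F (u, v)) hd).clm_apply
    (hasDerivAt_const t ((0 : ℝ), (1 : ℝ)))
  have d2 := (hasDerivAt_pθ_fderiv (f := fun u v => fderiv ℝ F (u, v)) hd).clm_apply
    (hasDerivAt_const θ ((1 : ℝ), (0 : ℝ)))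
  rw [e1, e2]
  refine d1.deriv.trans (Eq.trans ?_ d2.deriv.symm)
  simpa using hs (1, 0) (0, 1)

end Partials

lemma gram3 (a b C D : V3) (hab : dot3 a b = 0) :
    dot3 a a * dot3 b b * dot3 C D = dot3 b b * dot3 C a * dot3 D a
      + dot3 a a * dot3 C b * dot3 D b + dot3 C (cross3 a b) * dot3 D (cross3 a b) := by
  have h : dot3 C (cross3 a b) * dot3 D (cross3 a b) =
      dot3 C D * (dot3 a a * dot3 b b - dot3 a b ^ 2)
      - dot3 C a * (dot3 a D * dot3 b b - dot3 a b * dot3 b D)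
      + dot3 C b * (dot3 a D * dot3 a b - dot3 a a * dot3 b D) := by
    simp [dot3, cross3]; ring
  rw [h, hab]
  simp only [dot3]; ring

lemma dot3_comm (a b : V3) : dot3 a b = dot3 b a := by simp only [dot3]; ring

lemma dot3_cross_self (a b : V3) :
    dot3 (cross3 a b) (cross3 a b) = dot3 a a * dot3 b b - dot3 a b ^ 2 := by
  simp [dot3, cross3]; ring

lemma unit_dot_left (a b : V3) (c : ℝ) : dot3 (c • cross3 a b) a = 0 := by
  simp [dot3, cross3]; ring

lemma unit_dot_right (a b : V3) (c : ℝ) : dot3 (c • cross3 a b) b = 0 := by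
  simp [dot3, cross3]; ring

/-- Expansion of a scalar product in the orthogonal frame `a, b, N`. -/
lemma frame3 (a b C D N : V3) (hab : dot3 a b = 0) (hW : cross3 a b ≠ 0)
    (hN : N = (norm3 (cross3 a b))⁻¹ • cross3 a b) :
    0 < dot3 a a ∧ 0 < dot3 b b ∧
    dot3 C D = dot3 C a * dot3 D a / dot3 a a + dot3 C b * dot3 D b / dot3 b b
      + dot3 C N * dot3 D N := by
  have hw := norm3_pos hW
  have hp := dot3_self_pos hW
  have h2 := norm3_sq (cross3 a b)
  have hg := gram3 a b C D hab
  have ha : a ≠ 0 := by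
    rintro rfl; apply hW; ext i; fin_cases i <;> simp [cross3]
  have hb : b ≠ 0 := by
    rintro rfl; apply hW; ext i; fin_cases i <;> simp [cross3]
  have hE := dot3_self_pos ha
  have hG := dot3_self_pos hb
  refine ⟨hE, hG, ?_⟩
  have hc : ∀ C : V3, dot3 C N = (norm3 (cross3 a b))⁻¹ * dot3 C (cross3 a b) := by
    intro C; rw [hN]; simp only [dot3, Pi.smul_apply, smul_eq_mul]; ring
  rw [hc, hc]
  rw [dot3_cross_self, hab] at h2
  have h3 : (norm3 (cross3 a b))⁻¹ * (norm3 (cross3 a b))⁻¹ = (dot3 a a * dot3 b b)⁻¹ := by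
    rw [← mul_inv, ← sq, h2]; simp
  have h4 : (norm3 (cross3 a b))⁻¹ * dot3 C (cross3 a b) *
      ((norm3 (cross3 a b))⁻¹ * dot3 D (cross3 a b)) =
      (dot3 a a * dot3 b b)⁻¹ * (dot3 C (cross3 a b) * dot3 D (cross3 a b)) := by
    rw [← h3]; ring
  rw [h4]
  field_simp
  linarith

end Aux

section Variation

/-- Mean curvature in terms of the first and second derivatives of the parametrization. -/
def mcv (a b C11 C12 C22 : V3) : ℝ :=
  (dot3 a a * dot3 C22 ((norm3 (cross3 a b))⁻¹ • cross3 a b)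
    - 2 * dot3 a b * dot3 C12 ((norm3 (cross3 a b))⁻¹ • cross3 a b)
    + dot3 b b * dot3 C11 ((norm3 (cross3 a b))⁻¹ • cross3 a b))
  / (2 * (dot3 a a * dot3 b b - dot3 a b ^ 2))

lemma affine_hasDerivAt (a a1 : V3) : HasDerivAt (fun s : ℝ => a + s • a1) a1 0 := by
  simpa using ((hasDerivAt_id (0 : ℝ)).smul_const a1).const_add a

lemma mcv_hasDerivAt (a b N a1 b1 C11 C12 C22 D11 D12 D22 : V3)
    (hab : dot3 a b = 0) (hW : cross3 a b ≠ 0)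
    (hN : N = (norm3 (cross3 a b))⁻¹ • cross3 a b) (E G L M Q E1 F1 G1 L1 Q1 : ℝ)
    (hE : E = dot3 a a) (hG : G = dot3 b b) (hL : L = dot3 C11 N) (hM : M = dot3 C12 N)
    (hQ : Q = dot3 C22 N) (hE1 : E1 = 2 * dot3 a a1) (hF1 : F1 = dot3 a1 b + dot3 a b1)
    (hG1 : G1 = 2 * dot3 b b1)
    (hL1 : L1 = dot3 D11 N - dot3 C11 a * dot3 N a1 / E - dot3 C11 b * dot3 N b1 / G)
    (hQ1 : Q1 = dot3 D22 N - dot3 C22 a * dot3 N a1 / E - dot3 C22 b * dot3 N b1 / G) :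
    HasDerivAt (fun s : ℝ => mcv (a + s • a1) (b + s • b1) (C11 + s • D11) (C12 + s • D12)
      (C22 + s • D22))
      (((E1 * Q + E * Q1 - 2 * F1 * M + G1 * L + G * L1) * (2 * (E * G))
        - (E * Q + G * L) * (2 * (E1 * G + E * G1))) / (2 * (E * G)) ^ 2) 0 := by
  have dA := affine_hasDerivAt a a1
  have dB := affine_hasDerivAt b b1
  have d11 := affine_hasDerivAt C11 D11
  have d12 := affine_hasDerivAt C12 D12
  have d22 := affine_hasDerivAt C22 D22
  set A := fun s : ℝ => a + s • a1 with hA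
  set B := fun s : ℝ => b + s • b1 with hB
  have A0 : A 0 = a := by simp [hA]
  have B0 : B 0 = b := by simp [hB]
  have dW : DifferentiableAt ℝ (fun s => cross3 (A s) (B s)) 0 :=
    cross3_differentiableAt dA.differentiableAt dB.differentiableAt
  have hW0 : cross3 (A 0) (B 0) ≠ 0 := by rw [A0, B0]; exact hW
  have dn := (unit_differentiableAt dW hW0).hasDerivAt
  set n := fun s => (norm3 (cross3 (A s) (B s)))⁻¹ • cross3 (A s) (B s) with hn
  have n0 : n 0 = N := by simp only [hn]; rw [A0, B0, hN]
  set n' := deriv n 0 with hn'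
  have k1 : dot3 n' N = 0 := by
    have h := dot3_hasDerivAt dn dn
    have h' : HasDerivAt (fun s => dot3 (n s) (n s)) 0 0 := by
      refine (hasDerivAt_const (0 : ℝ) (1 : ℝ)).congr_of_eventuallyEq ?_
      filter_upwards [dW.continuousAt.eventually_ne hW0] with s hs using unit_self hs
    have := h.unique h'
    rw [n0, dot3_comm N] at this; linarith
  have k2 : dot3 n' a = - dot3 N a1 := by
    have h := dot3_hasDerivAt dn dA
    have h' : HasDerivAt (fun s => dot3 (n s) (A s)) 0 0 := by
      refine (hasDerivAt_const (0 : ℝ) (0 : ℝ)).congr_of_eventuallyEq ?_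
      exact Filter.Eventually.of_forall fun s => unit_dot_left _ _ _
    have := h.unique h'
    rw [n0, A0] at this; linarith
  have k3 : dot3 n' b = - dot3 N b1 := by
    have h := dot3_hasDerivAt dn dB
    have h' : HasDerivAt (fun s => dot3 (n s) (B s)) 0 0 := by
      refine (hasDerivAt_const (0 : ℝ) (0 : ℝ)).congr_of_eventuallyEq ?_
      exact Filter.Eventually.of_forall fun s => unit_dot_right _ _ _
    have := h.unique h'
    rw [n0, B0] at this; linarith
  obtain ⟨pE, pG, -⟩ := frame3 a b a a N hab hW hN
  have c11 := (frame3 a b C11 n' N hab hW hN).2.2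
  have c22 := (frame3 a b C22 n' N hab hW hN).2.2
  rw [k1, k2, k3, ← hE, ← hG] at c11 c22
  have main := ((((dot3_hasDerivAt dA dA).mul (dot3_hasDerivAt d22 dn)).sub
    (((dot3_hasDerivAt dA dB).const_mul 2).mul (dot3_hasDerivAt d12 dn))).add
    ((dot3_hasDerivAt dB dB).mul (dot3_hasDerivAt d11 dn))).div
    ((((dot3_hasDerivAt dA dA).mul (dot3_hasDerivAt dB dB)).sub
      ((dot3_hasDerivAt dA dB).pow 2)).const_mul 2) (by
        simp only [A0, B0, hab, Pi.sub_apply, Pi.mul_apply, Pi.pow_apply]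
        have := mul_pos pE pG
        intro h0
        nlinarith)
  refine main.congr_deriv ?_
  simp only [Pi.sub_apply, Pi.mul_apply, Pi.pow_apply, Pi.add_apply, A0, B0, n0, zero_smul,
    add_zero, hab, c11, c22, dot3_comm a1 a, dot3_comm b1 b, ← hE, ← hG, ← hL, ← hM, ← hQ]
  rw [hE1, hF1, hG1, hL1, hQ1, dot3_comm a1 b]
  congr 1
  · push_cast; ring
  · ring

end Variation

section Pert

variable {E : Type*} [NormedAddCommGroup E] [NormedSpace ℝ E] {Ω : Set (ℝ × ℝ)} {t θ : ℝ}

lemma pt_affine (hΩ : IsOpen Ω) {Y Z : ℝ → ℝ → E}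
    (hY : ContDiffOn ℝ 1 (fun p : ℝ × ℝ => Y p.1 p.2) Ω)
    (hZ : ContDiffOn ℝ 1 (fun p : ℝ × ℝ => Z p.1 p.2) Ω) (s : ℝ) (hp : (t, θ) ∈ Ω) :
    pt (fun u v => Y u v + s • Z u v) t θ = pt Y t θ + s • pt Z t θ :=
  ((hasDerivAt_pt hΩ hY hp).add ((hasDerivAt_pt hΩ hZ hp).const_smul s)).deriv

lemma pθ_affine (hΩ : IsOpen Ω) {Y Z : ℝ → ℝ → E}
    (hY : ContDiffOn ℝ 1 (fun p : ℝ × ℝ => Y p.1 p.2) Ω)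
    (hZ : ContDiffOn ℝ 1 (fun p : ℝ × ℝ => Z p.1 p.2) Ω) (s : ℝ) (hp : (t, θ) ∈ Ω) :
    pθ (fun u v => Y u v + s • Z u v) t θ = pθ Y t θ + s • pθ Z t θ :=
  ((hasDerivAt_pθ hΩ hY hp).add ((hasDerivAt_pθ hΩ hZ hp).const_smul s)).deriv

lemma pt_smul (hΩ : IsOpen Ω) {f : ℝ → ℝ → ℝ} {Z : ℝ → ℝ → E}
    (hf : ContDiffOn ℝ 1 (fun p : ℝ × ℝ => f p.1 p.2) Ω)
    (hZ : ContDiffOn ℝ 1 (fun p : ℝ × ℝ => Z p.1 p.2) Ω) (hp : (t, θ) ∈ Ω) :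
    pt (fun u v => f u v • Z u v) t θ = f t θ • pt Z t θ + pt f t θ • Z t θ :=
  ((hasDerivAt_pt hΩ hf hp).smul (hasDerivAt_pt hΩ hZ hp)).deriv

lemma pθ_smul (hΩ : IsOpen Ω) {f : ℝ → ℝ → ℝ} {Z : ℝ → ℝ → E}
    (hf : ContDiffOn ℝ 1 (fun p : ℝ × ℝ => f p.1 p.2) Ω)
    (hZ : ContDiffOn ℝ 1 (fun p : ℝ × ℝ => Z p.1 p.2) Ω) (hp : (t, θ) ∈ Ω) :
    pθ (fun u v => f u v • Z u v) t θ = f t θ • pθ Z t θ + pθ f t θ • Z t θ :=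
  ((hasDerivAt_pθ hΩ hf hp).smul (hasDerivAt_pθ hΩ hZ hp)).deriv

lemma pt_pt_smul (hΩ : IsOpen Ω) {f : ℝ → ℝ → ℝ} {Z : ℝ → ℝ → E}
    (hf : ContDiffOn ℝ 2 (fun p : ℝ × ℝ => f p.1 p.2) Ω)
    (hZ : ContDiffOn ℝ 2 (fun p : ℝ × ℝ => Z p.1 p.2) Ω) (hp : (t, θ) ∈ Ω) :
    pt (pt (fun u v => f u v • Z u v)) t θ
      = f t θ • pt (pt Z) t θ + (2 * pt f t θ) • pt Z t θ + pt (pt f) t θ • Z t θ := by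
  have hf1 := hf.of_le (m := 1) (by norm_num)
  have hZ1 := hZ.of_le (m := 1) (by norm_num)
  have hft := contDiffOn_pt (m := 1) hΩ (by norm_num) hf
  have hZt := contDiffOn_pt (m := 1) hΩ (by norm_num) hZ
  rw [pt_congr (g := fun u v => f u v • pt Z u v + pt f u v • Z u v) hΩ
    (fun p hp => pt_smul hΩ hf1 hZ1 hp) hp]
  refine (((hasDerivAt_pt hΩ hf1 hp).smul (hasDerivAt_pt hΩ hZt hp)).add
    ((hasDerivAt_pt hΩ hft hp).smul (hasDerivAt_pt hΩ hZ1 hp))).deriv.trans ?_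
  module

lemma pθ_pθ_smul (hΩ : IsOpen Ω) {f : ℝ → ℝ → ℝ} {Z : ℝ → ℝ → E}
    (hf : ContDiffOn ℝ 2 (fun p : ℝ × ℝ => f p.1 p.2) Ω)
    (hZ : ContDiffOn ℝ 2 (fun p : ℝ × ℝ => Z p.1 p.2) Ω) (hp : (t, θ) ∈ Ω) :
    pθ (pθ (fun u v => f u v • Z u v)) t θ
      = f t θ • pθ (pθ Z) t θ + (2 * pθ f t θ) • pθ Z t θ + pθ (pθ f) t θ • Z t θ := by
  have hf1 := hf.of_le (m := 1) (by norm_num)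
  have hZ1 := hZ.of_le (m := 1) (by norm_num)
  have hft := contDiffOn_pθ (m := 1) hΩ (by norm_num) hf
  have hZt := contDiffOn_pθ (m := 1) hΩ (by norm_num) hZ
  rw [pθ_congr (g := fun u v => f u v • pθ Z u v + pθ f u v • Z u v) hΩ
    (fun p hp => pθ_smul hΩ hf1 hZ1 hp) hp]
  refine (((hasDerivAt_pθ hΩ hf1 hp).smul (hasDerivAt_pθ hΩ hZt hp)).add
    ((hasDerivAt_pθ hΩ hft hp).smul (hasDerivAt_pθ hΩ hZ1 hp))).deriv.trans ?_
  module

lemma pt_dot3 (hΩ : IsOpen Ω) {Y Z : ℝ → ℝ → V3}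
    (hY : ContDiffOn ℝ 1 (fun p : ℝ × ℝ => Y p.1 p.2) Ω)
    (hZ : ContDiffOn ℝ 1 (fun p : ℝ × ℝ => Z p.1 p.2) Ω) (hp : (t, θ) ∈ Ω) :
    pt (fun u v => dot3 (Y u v) (Z u v)) t θ
      = dot3 (pt Y t θ) (Z t θ) + dot3 (Y t θ) (pt Z t θ) :=
  (dot3_hasDerivAt (hasDerivAt_pt hΩ hY hp) (hasDerivAt_pt hΩ hZ hp)).deriv

lemma pθ_dot3 (hΩ : IsOpen Ω) {Y Z : ℝ → ℝ → V3}
    (hY : ContDiffOn ℝ 1 (fun p : ℝ × ℝ => Y p.1 p.2) Ω)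
    (hZ : ContDiffOn ℝ 1 (fun p : ℝ × ℝ => Z p.1 p.2) Ω) (hp : (t, θ) ∈ Ω) :
    pθ (fun u v => dot3 (Y u v) (Z u v)) t θ
      = dot3 (pθ Y t θ) (Z t θ) + dot3 (Y t θ) (pθ Z t θ) :=
  (dot3_hasDerivAt (hasDerivAt_pθ hΩ hY hp) (hasDerivAt_pθ hΩ hZ hp)).deriv

/-- If `Y · Z` is constant on `Ω`, its derivative along `t` vanishes. -/
lemma pt_dot3_const (hΩ : IsOpen Ω) {Y Z : ℝ → ℝ → V3} (c : ℝ)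
    (hY : ContDiffOn ℝ 1 (fun p : ℝ × ℝ => Y p.1 p.2) Ω)
    (hZ : ContDiffOn ℝ 1 (fun p : ℝ × ℝ => Z p.1 p.2) Ω)
    (h : ∀ p ∈ Ω, dot3 (Y p.1 p.2) (Z p.1 p.2) = c) (hp : (t, θ) ∈ Ω) :
    dot3 (pt Y t θ) (Z t θ) + dot3 (Y t θ) (pt Z t θ) = 0 := by
  rw [← pt_dot3 hΩ hY hZ hp, pt_congr (g := fun _ _ => c) hΩ h hp]
  simp [pt]

lemma pθ_dot3_const (hΩ : IsOpen Ω) {Y Z : ℝ → ℝ → V3} (c : ℝ)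
    (hY : ContDiffOn ℝ 1 (fun p : ℝ × ℝ => Y p.1 p.2) Ω)
    (hZ : ContDiffOn ℝ 1 (fun p : ℝ × ℝ => Z p.1 p.2) Ω)
    (h : ∀ p ∈ Ω, dot3 (Y p.1 p.2) (Z p.1 p.2) = c) (hp : (t, θ) ∈ Ω) :
    dot3 (pθ Y t θ) (Z t θ) + dot3 (Y t θ) (pθ Z t θ) = 0 := by
  rw [← pθ_dot3 hΩ hY hZ hp, pθ_congr (g := fun _ _ => c) hΩ h hp]
  simp [pθ]

lemma dot3_add_right (a b c : V3) : dot3 a (b + c) = dot3 a b + dot3 a c := by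
  simp only [dot3, Pi.add_apply]; ring

lemma dot3_smul_right (a b : V3) (c : ℝ) : dot3 a (c • b) = c * dot3 a b := by
  simp only [dot3, Pi.smul_apply, smul_eq_mul]; ring

lemma dot3_add_left (a b c : V3) : dot3 (b + c) a = dot3 b a + dot3 c a := by
  simp only [dot3, Pi.add_apply]; ring

lemma dot3_smul_left (a b : V3) (c : ℝ) : dot3 (c • b) a = c * dot3 b a := by
  simp only [dot3, Pi.smul_apply, smul_eq_mul]; ring

end Pert

/-- First variation of the mean curvature under normal perturbations of an
orthogonal parametrization. -/
theorem first_variation_mean_curvature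
    (Ω : Set (ℝ × ℝ)) (hΩo : IsOpen Ω) (hΩc : IsConnected Ω)
    (X : ℝ → ℝ → V3)
    (hX : ContDiffOn ℝ (⊤ : ℕ∞) (fun p : ℝ × ℝ => X p.1 p.2) Ω)
    (horth : ∀ p : ℝ × ℝ, p ∈ Ω → dot3 (pt X p.1 p.2) (pθ X p.1 p.2) = 0)
    (hreg : ∀ p : ℝ × ℝ, p ∈ Ω → cross3 (pt X p.1 p.2) (pθ X p.1 p.2) ≠ 0)
    (φ : ℝ → ℝ → ℝ)
    (hφ : ContDiffOn ℝ 2 (fun p : ℝ × ℝ => φ p.1 p.2) Ω) :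
    ∀ t θ : ℝ, (t, θ) ∈ Ω →
      HasDerivAt (fun s : ℝ => meanCurv (pert X φ s) t θ)
        (firstVariation X φ t θ) 0 := by
  intro t θ hp
  have hX3 : ContDiffOn ℝ 3 (fun p : ℝ × ℝ => X p.1 p.2) Ω := hX.of_le
    (WithTop.coe_le_coe.2 (le_top : (3 : ℕ∞) ≤ ⊤))
  have hX2 := hX3.of_le (m := 2) (by norm_num)
  have hX1 := hX3.of_le (m := 1) (by norm_num)
  have ha2 := contDiffOn_pt (m := 2) hΩo (by norm_num) hX3
  have hb2 := contDiffOn_pθ (m := 2) hΩo (by norm_num) hX3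
  have ha1 := ha2.of_le (m := 1) (by norm_num)
  have hb1 := hb2.of_le (m := 1) (by norm_num)
  have hN2 : ContDiffOn ℝ 2 (fun p : ℝ × ℝ => normalVec X p.1 p.2) Ω :=
    unit_contDiffOn (cross3_contDiffOn ha2 hb2) hreg
  have hN1 := hN2.of_le (m := 1) (by norm_num)
  have hNt := contDiffOn_pt (m := 1) hΩo (by norm_num) hN2
  have hNθ := contDiffOn_pθ (m := 1) hΩo (by norm_num) hN2
  have hφ1 := hφ.of_le (m := 1) (by norm_num)
  have nn : ∀ p ∈ Ω, dot3 (normalVec X p.1 p.2) (normalVec X p.1 p.2) = 1 :=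
    fun p hp => unit_self (hreg p hp)
  have na : ∀ p ∈ Ω, dot3 (normalVec X p.1 p.2) (pt X p.1 p.2) = 0 :=
    fun p hp => unit_dot_left _ _ _
  have nb : ∀ p ∈ Ω, dot3 (normalVec X p.1 p.2) (pθ X p.1 p.2) = 0 :=
    fun p hp => unit_dot_right _ _ _
  have hcomm := pt_pθ_comm hΩo hX2 hp
  -- first-order relations
  have r1 := pt_dot3_const hΩo 0 hN1 ha1 na hp
  have r2 := pθ_dot3_const hΩo 0 hN1 ha1 na hp
  have r3 := pt_dot3_const hΩo 0 hN1 hb1 nb hp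
  have r4 := pθ_dot3_const hΩo 0 hN1 hb1 nb hp
  have r5 := pt_dot3_const hΩo 0 ha1 hb1 horth hp
  have r6 := pθ_dot3_const hΩo 0 ha1 hb1 horth hp
  have nt0 : ∀ p ∈ Ω, dot3 (normalVec X p.1 p.2) (pt (normalVec X) p.1 p.2) = 0 := by
    intro p hp
    have := pt_dot3_const hΩo 1 hN1 hN1 nn (t := p.1) (θ := p.2) hp
    rw [dot3_comm (pt _ _ _)] at this; linarith
  have nθ0 : ∀ p ∈ Ω, dot3 (normalVec X p.1 p.2) (pθ (normalVec X) p.1 p.2) = 0 := by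
    intro p hp
    have := pθ_dot3_const hΩo 1 hN1 hN1 nn (t := p.1) (θ := p.2) hp
    rw [dot3_comm (pθ _ _ _)] at this; linarith
  have r7 := pt_dot3_const hΩo 0 hN1 hNt nt0 hp
  have r8 := pθ_dot3_const hΩo 0 hN1 hNθ nθ0 hp
  have q1 := pt_dot3 hΩo ha1 ha1 hp
  have q2 := pθ_dot3 hΩo ha1 ha1 hp
  have q3 := pt_dot3 hΩo hb1 hb1 hp
  have q4 := pθ_dot3 hΩo hb1 hb1 hp
  have z1 := nn _ hp
  have z2 := na _ hp
  have z3 := nb _ hp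
  have z4 := nt0 _ hp
  have z5 := nθ0 _ hp
  have z6 := horth _ hp
  have hW := hreg _ hp
  dsimp only at z1 z2 z3 z4 z5 z6 hW
  -- the perturbation
  set Z : ℝ → ℝ → V3 := fun u v => φ u v • normalVec X u v with hZdef
  have hZ2 : ContDiffOn ℝ 2 (fun p : ℝ × ℝ => Z p.1 p.2) Ω := hφ.smul hN2
  have hZ1 := hZ2.of_le (m := 1) (by norm_num)
  have hZt := contDiffOn_pt (m := 1) hΩo (by norm_num) hZ2
  have hZθ := contDiffOn_pθ (m := 1) hΩo (by norm_num) hZ2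
  have hpert : ∀ s, pert X φ s = fun u v => X u v + s • Z u v := by
    intro s; funext u v; simp only [pert, hZdef, smul_smul]
  have p1 : ∀ s, ∀ p ∈ Ω, pt (pert X φ s) p.1 p.2 = pt X p.1 p.2 + s • pt Z p.1 p.2 := by
    intro s p hp; rw [hpert]; exact pt_affine hΩo hX1 hZ1 s hp
  have p2 : ∀ s, ∀ p ∈ Ω, pθ (pert X φ s) p.1 p.2 = pθ X p.1 p.2 + s • pθ Z p.1 p.2 := by
    intro s p hp; rw [hpert]; exact pθ_affine hΩo hX1 hZ1 s hp
  have p11 : ∀ s, pt (pt (pert X φ s)) t θ = pt (pt X) t θ + s • pt (pt Z) t θ := by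
    intro s
    rw [pt_congr (g := fun u v => pt X u v + s • pt Z u v) hΩo (p1 s) hp]
    exact pt_affine hΩo ha1 hZt s hp
  have p12 : ∀ s, pθ (pt (pert X φ s)) t θ = pθ (pt X) t θ + s • pθ (pt Z) t θ := by
    intro s
    rw [pθ_congr (g := fun u v => pt X u v + s • pt Z u v) hΩo (p1 s) hp]
    exact pθ_affine hΩo ha1 hZt s hp
  have p22 : ∀ s, pθ (pθ (pert X φ s)) t θ = pθ (pθ X) t θ + s • pθ (pθ Z) t θ := by
    intro s
    rw [pθ_congr (g := fun u v => pθ X u v + s • pθ Z u v) hΩo (p2 s) hp]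
    exact pθ_affine hΩo hb1 hZθ s hp
  have hmc : (fun s : ℝ => meanCurv (pert X φ s) t θ) = fun s : ℝ =>
      mcv (pt X t θ + s • pt Z t θ) (pθ X t θ + s • pθ Z t θ)
        (pt (pt X) t θ + s • pt (pt Z) t θ) (pθ (pt X) t θ + s • pθ (pt Z) t θ)
        (pθ (pθ X) t θ + s • pθ (pθ Z) t θ) := by
    funext s
    have e1 := p1 s _ hp
    have e2 := p2 s _ hp
    dsimp only at e1 e2
    simp only [meanCurv, normalVec, mcv, p11, p12, p22, e1, e2]
  rw [hmc]
  refine (mcv_hasDerivAt _ _ (normalVec X t θ) _ _ _ _ _ _ _ _ z6 hW rfl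
    _ _ _ _ _ _ _ _ _ _ rfl rfl rfl rfl rfl rfl rfl rfl rfl rfl).congr_deriv ?_
  obtain ⟨pE, pG, -⟩ := frame3 (pt X t θ) (pθ X t θ) 0 0 (normalVec X t θ) z6 hW rfl
  have ftt := (frame3 (pt X t θ) (pθ X t θ) (pt (normalVec X) t θ) (pt (normalVec X) t θ)
    (normalVec X t θ) z6 hW rfl).2.2
  simp only [firstVariation]
  rw [q1, q2, q3, q4]
  rw [hZdef, pt_smul hΩo hφ1 hN1 hp, pθ_smul hΩo hφ1 hN1 hp, pt_pt_smul hΩo hφ hN2 hp,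
    pθ_pθ_smul hΩo hφ hN2 hp]
  rw [hcomm] at r3 r5 ⊢
  clear q1 q2 q3 q4 hmc p11 p12 p22 p1 p2 hpert ftt
  simp only [dot3_add_right, dot3_add_left, dot3_smul_left, dot3_smul_right]
  generalize normalVec X t θ = N at *
  generalize pt (normalVec X) t θ = Nt at *
  generalize pθ (normalVec X) t θ = Nθ at *
  generalize pt (pt (normalVec X)) t θ = Ntt at *
  generalize pθ (pθ (normalVec X)) t θ = Nθθ at *
  generalize pt (pt X) t θ = Xtt at *
  generalize pθ (pt X) t θ = Xtθ at *
  generalize pθ (pθ X) t θ = Xθθ at *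
  generalize pt X t θ = a at *
  generalize pθ X t θ = b at *
  rw [dot3_comm a Nt, dot3_comm a Nθ, dot3_comm b Nθ, dot3_comm a N,
    dot3_comm b N, dot3_comm Nt N, dot3_comm Nθ N, dot3_comm Ntt N, dot3_comm Nθθ N,
    dot3_comm a Xtt, dot3_comm a Xtθ, dot3_comm b Xtθ, dot3_comm b Xθθ,
    dot3_comm Xtt N, dot3_comm Xtθ N, dot3_comm Xθθ N]
  rw [dot3_comm a Xtθ] at r5
  rw [dot3_comm a Xθθ] at r6
  have s1 : dot3 Nt a = - dot3 N Xtt := by linarith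
  have s2 : dot3 Nθ a = - dot3 N Xtθ := by linarith
  have s3 : dot3 Nt b = - dot3 N Xtθ := by linarith
  have s4 : dot3 Nθ b = - dot3 N Xθθ := by linarith
  have s5 : dot3 Xtt b = - dot3 Xtθ a := by linarith
  have s6 : dot3 Xθθ a = - dot3 Xtθ b := by linarith
  have s7 : dot3 N Ntt = - dot3 Nt Nt := by linarith
  have s8 : dot3 N Nθθ = - dot3 Nθ Nθ := by linarith
  rw [s1, s2, s3, s4, s5, s6, s7, s8, z1, z2, z3, z4, z5]
  field_simp
  ring

end Delaunay
end
end
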